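/- arXiv:2201.11545 — 3 statements merged into one kernel-verified Lean document; each statement's English description precedes it below -/
import Mathlib

section
/- For any tiling of a rectangle by n axis-parallel squares, there exists a positive real scaling factor such that, after scaling the tiled rectangle by this factor, all square tiles have integer side lengths and the longest side of the rectangle has length at most 4^n. -/
namespace SqTile

open MeasureTheory

lemma det_le {ι : Type*} [Fintype ι] [DecidableEq ι] (M : Matrix ι ι ℤ) :
    |M.det| ≤ ∏ i, ∑ j, |M i j| := by
  rw [← Matrix.det_transpose, Matrix.det_apply]
  calc |∑ σ : Equiv.Perm ι, Equiv.Perm.sign σ • ∏ i, M.transpose (σ i) i|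
      ≤ ∑ σ : Equiv.Perm ι, |Equiv.Perm.sign σ • ∏ i, M.transpose (σ i) i| :=
        Finset.abs_sum_le_sum_abs _ _
    _ = ∑ σ : Equiv.Perm ι, ∏ i, |M i (σ i)| := by
        refine Finset.sum_congr rfl fun σ _ => ?_
        rcases Int.units_eq_one_or (Equiv.Perm.sign σ) with h | h <;>
          simp [h, Finset.abs_prod]
    _ ≤ ∑ f : ι → ι, ∏ i, |M i (f i)| := by
        have hinj : Function.Injective (fun σ : Equiv.Perm ι => (σ : ι → ι)) :=
          DFunLike.coe_injective
        rw [← Finset.sum_image (s := Finset.univ) (g := fun σ : Equiv.Perm ι => (σ : ι → ι))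
          (f := fun f : ι → ι => ∏ i, |M i (f i)|) (fun a _ b _ h => hinj h)]
        exact Finset.sum_le_sum_of_subset_of_nonneg (Finset.subset_univ _)
          (fun f _ _ => Finset.prod_nonneg fun i _ => abs_nonneg _)
    _ = ∏ i, ∑ j, |M i j| := by
        rw [Finset.prod_univ_sum]; simp

lemma two_mul_le_pow (k : ℕ) (h : 1 ≤ k) : 2 * k ≤ 2 ^ k := by
  induction k, h using Nat.le_induction with
  | base => norm_num
  | succ m hm ih => rw [pow_succ]; omega

lemma two_mul_le_pow' (k : ℕ) : 2 * k ≤ 2 ^ k := by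
  rcases Nat.eq_zero_or_pos k with h | h
  · simp [h]
  · exact two_mul_le_pow k h

/-- Gram-type matrices whose columns have L1 norm at most two: any matrix whose rows are
either rows of the Gram matrix or unit vectors has small determinant. -/
lemma det_bound {ι : Type*} [Fintype ι] [DecidableEq ι] {n : ℕ} (B : ι → Fin n → ℤ)
    (hB : ∀ i, ∑ v, |B v i| ≤ 2) (M : Matrix ι ι ℤ)
    (hM : ∀ u, (∀ v, M u v = ∑ i, B u i * B v i) ∨ ∑ v, |M u v| ≤ 1) :
    |M.det| ≤ 4 ^ n := by
  have hdeg : ∑ u, ∑ i, (B u i).natAbs ≤ 2 * n := by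
    rw [Finset.sum_comm]
    calc _ ≤ ∑ i : Fin n, 2 := by
          refine Finset.sum_le_sum fun i _ => ?_
          have := hB i
          zify
          exact this
      _ = 2 * n := by simp [mul_comm]
  calc |M.det| ≤ ∏ u, ∑ v, |M u v| := det_le M
    _ ≤ ∏ u, (2 : ℤ) ^ (∑ i, (B u i).natAbs) := by
        refine Finset.prod_le_prod (fun u _ => Finset.sum_nonneg fun v _ => abs_nonneg _) ?_
        intro u _
        rcases hM u with h | h
        · calc ∑ v, |M u v| ≤ ∑ v, ∑ i, |B u i| * |B v i| := by
                refine Finset.sum_le_sum fun v _ => ?_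
                rw [h v]
                refine (Finset.abs_sum_le_sum_abs _ _).trans (le_of_eq ?_)
                simp [abs_mul]
            _ = ∑ i, |B u i| * ∑ v, |B v i| := by
                rw [Finset.sum_comm]; simp [Finset.mul_sum]
            _ ≤ ∑ i, |B u i| * 2 :=
                Finset.sum_le_sum fun i _ => mul_le_mul_of_nonneg_left (hB i) (abs_nonneg _)
            _ = ((2 * ∑ i, (B u i).natAbs : ℕ) : ℤ) := by
                push_cast
                rw [← Finset.sum_mul, mul_comm]
            _ ≤ ((2 ^ (∑ i, (B u i).natAbs) : ℕ) : ℤ) := by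
                exact_mod_cast two_mul_le_pow' _
            _ = _ := by push_cast; rfl
        · exact h.trans (one_le_pow₀ (by norm_num))
    _ = (2 : ℤ) ^ (∑ u, ∑ i, (B u i).natAbs) := by rw [Finset.prod_pow_eq_pow_sum]
    _ ≤ 2 ^ (2 * n) := pow_le_pow_right₀ (by norm_num) hdeg
    _ = 4 ^ n := by rw [pow_mul]; norm_num

section
variable {a b c d : ℝ} {n : ℕ} {x y s : Fin n → ℝ}

lemma bounds (hs : ∀ i, 0 < s i)
    (hunion : (⋃ i, Set.Icc (x i) (x i + s i) ×ˢ Set.Icc (y i) (y i + s i))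
      = Set.Icc a b ×ˢ Set.Icc c d) (i : Fin n) :
    a ≤ x i ∧ x i + s i ≤ b ∧ c ≤ y i ∧ y i + s i ≤ d := by
  have hi := hs i
  have h1 : (x i, y i) ∈ Set.Icc a b ×ˢ Set.Icc c d := by
    rw [← hunion]; refine Set.mem_iUnion.2 ⟨i, ?_⟩
    constructor <;> constructor <;> simp <;> linarith
  have h2 : (x i + s i, y i + s i) ∈ Set.Icc a b ×ˢ Set.Icc c d := by
    rw [← hunion]; refine Set.mem_iUnion.2 ⟨i, ?_⟩
    constructor <;> constructor <;> simp <;> linarith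
  exact ⟨h1.1.1, h2.1.2, h1.2.1, h2.2.2⟩

open Classical in
lemma section_sum (hab : a < b) (hs : ∀ i, 0 < s i)
    (hdisj : ∀ i j, i ≠ j →
      (Set.Ioo (x i) (x i + s i) ×ˢ Set.Ioo (y i) (y i + s i)) ∩
      (Set.Ioo (x j) (x j + s j) ×ˢ Set.Ioo (y j) (y j + s j)) = ∅)
    (hunion : (⋃ i, Set.Icc (x i) (x i + s i) ×ˢ Set.Icc (y i) (y i + s i))
      = Set.Icc a b ×ˢ Set.Icc c d) (t : ℝ) (hct : c ≤ t) (htd : t ≤ d)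
    (h1 : ∀ i, y i ≠ t) (h2 : ∀ i, y i + s i ≠ t) :
    ∑ i, (if y i < t ∧ t < y i + s i then s i else 0) = b - a := by
  rw [← Finset.sum_filter]
  set S := Finset.univ.filter (fun i => y i < t ∧ t < y i + s i) with hS
  have hnn : 0 ≤ ∑ i ∈ S, s i := Finset.sum_nonneg fun i _ => (hs i).le
  have e1 : volume (⋃ i ∈ S, Set.Ioo (x i) (x i + s i)) = ENNReal.ofReal (∑ i ∈ S, s i) := by
    rw [measure_biUnion_finset]
    · rw [ENNReal.ofReal_sum_of_nonneg fun i _ => (hs i).le]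
      simp
    · intro i hi j hj hij
      refine Set.disjoint_left.2 fun z hz hz' => ?_
      have hi' := (Finset.mem_filter.1 hi).2
      have hj' := (Finset.mem_filter.1 hj).2
      have : (z, t) ∈ (∅ : Set (ℝ × ℝ)) := by
        rw [← hdisj i j hij]
        exact ⟨⟨hz, hi'⟩, ⟨hz', hj'⟩⟩
      exact this
    · intro i _; exact measurableSet_Ioo
  have e2 : volume (⋃ i ∈ S, Set.Ioo (x i) (x i + s i)) ≤ volume (Set.Icc a b) := by
    refine measure_mono (Set.iUnion₂_subset fun i _ z hz => ?_)
    have := bounds hs hunion i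
    exact ⟨by linarith [hz.1], by linarith [hz.2]⟩
  have e3 : volume (Set.Icc a b) ≤ ∑ i ∈ S, volume (Set.Icc (x i) (x i + s i)) := by
    refine (measure_mono ?_).trans (measure_biUnion_finset_le S _)
    intro z hz
    have : (z, t) ∈ ⋃ i, Set.Icc (x i) (x i + s i) ×ˢ Set.Icc (y i) (y i + s i) := by
      rw [hunion]; exact ⟨hz, hct, htd⟩
    obtain ⟨i, hi⟩ := Set.mem_iUnion.1 this
    refine Set.mem_iUnion₂.2 ⟨i, ?_, hi.1⟩
    simp only [hS, Finset.mem_filter, Finset.mem_univ, true_and]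
    exact ⟨lt_of_le_of_ne hi.2.1 (h1 i), lt_of_le_of_ne hi.2.2 (h2 i).symm⟩
  have e4 : ∑ i ∈ S, volume (Set.Icc (x i) (x i + s i)) = ENNReal.ofReal (∑ i ∈ S, s i) := by
    rw [ENNReal.ofReal_sum_of_nonneg fun i _ => (hs i).le]
    simp
  rw [e1, Real.volume_Icc] at e2
  rw [e4, Real.volume_Icc] at e3
  apply le_antisymm
  · exact (ENNReal.ofReal_le_ofReal_iff (by linarith)).1 e2
  · exact (ENNReal.ofReal_le_ofReal_iff hnn).1 e3

open Classical in
lemma flow (hab : a < b) (hs : ∀ i, 0 < s i)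
    (hdisj : ∀ i j, i ≠ j →
      (Set.Ioo (x i) (x i + s i) ×ˢ Set.Ioo (y i) (y i + s i)) ∩
      (Set.Ioo (x j) (x j + s j) ×ˢ Set.Ioo (y j) (y j + s j)) = ∅)
    (hunion : (⋃ i, Set.Icc (x i) (x i + s i) ×ˢ Set.Icc (y i) (y i + s i))
      = Set.Icc a b ×ˢ Set.Icc c d) (u : ℝ) (hcu : c < u) (hud : u ≤ d) :
    ∑ i, ((if y i + s i = u then (1:ℝ) else 0) - (if y i = u then 1 else 0)) * s i
      = if u = d then b - a else 0 := by
  have hev : ∀ v : ℝ, ∀ᶠ e in nhdsWithin (0:ℝ) (Set.Ioi 0), v ≠ u → e < |v - u| := by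
    intro v
    by_cases hv : v = u
    · exact Filter.Eventually.of_forall fun e h => absurd hv h
    · have : 0 < |v - u| := abs_pos.2 (sub_ne_zero.2 hv)
      filter_upwards [nhdsWithin_le_nhds (Iio_mem_nhds this)] with e he _ using he
  have hall : ∀ᶠ e in nhdsWithin (0:ℝ) (Set.Ioi 0), 0 < e ∧ (c ≠ u → e < |c - u|) ∧
      (d ≠ u → e < |d - u|) ∧ (∀ i, y i ≠ u → e < |y i - u|) ∧
      (∀ i, y i + s i ≠ u → e < |y i + s i - u|) := by
    have h0 : ∀ᶠ e in nhdsWithin (0:ℝ) (Set.Ioi 0), 0 < e := self_mem_nhdsWithin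
    refine h0.and ((hev c).and ((hev d).and (Filter.Eventually.and ?_ ?_)))
    · exact Filter.eventually_all.2 fun i => hev _
    · exact Filter.eventually_all.2 fun i => hev _
  obtain ⟨e, he, hec, hed, hey, hes⟩ := hall.exists
  have hec := hec hcu.ne
  rw [abs_of_neg (by linarith)] at hec
  have key : ∀ v : ℝ, (v ≠ u → e < |v - u|) → v = u ∨ v < u - e ∨ u + e < v := by
    intro v hv
    by_cases h : v = u
    · exact .inl h
    · right
      rcases lt_abs.1 (hv h) with h | h
      · right; linarith
      · left; linarith
  have hy := fun i => key _ (hey i)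
  have hys := fun i => key _ (hes i)
  have m1 := section_sum hab hs hdisj hunion (u - e) (by linarith) (by linarith)
    (fun i h => by rcases hy i with h' | h' | h' <;> linarith)
    (fun i h => by rcases hys i with h' | h' | h' <;> linarith)
  have m2 : ∑ i, (if y i < u + e ∧ u + e < y i + s i then s i else 0)
      = if u = d then 0 else b - a := by
    split_ifs with h
    · refine Finset.sum_eq_zero fun i _ => if_neg ?_
      have := bounds hs hunion i
      rintro ⟨_, _⟩; linarith
    · have hd := key d hed
      refine section_sum hab hs hdisj hunion (u + e) (by linarith) ?_
        (fun i h => by rcases hy i with h' | h' | h' <;> linarith)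
        (fun i h => by rcases hys i with h' | h' | h' <;> linarith)
      rcases hd with h' | h' | h'
      · exact absurd h'.symm h
      · linarith
      · linarith
  have : (if u = d then b - a else 0) = (b - a) - (if u = d then 0 else b - a) := by
    split_ifs <;> ring
  rw [this, ← m2, ← m1, ← Finset.sum_sub_distrib]
  refine Finset.sum_congr rfl fun i _ => ?_
  have hi := hs i
  rcases hy i with h | h | h <;> rcases hys i with h' | h' | h'
  · linarith
  · linarith
  · rw [if_neg (by linarith), if_pos h, if_neg (by rintro ⟨_, _⟩; linarith),
      if_pos ⟨by linarith, by linarith⟩]; ring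
  · rw [if_pos h', if_neg (by linarith), if_pos ⟨by linarith, by linarith⟩,
      if_neg (by rintro ⟨_, _⟩; linarith)]; ring
  · rw [if_neg (by linarith), if_neg (by linarith), if_neg (by rintro ⟨_, _⟩; linarith),
      if_neg (by rintro ⟨_, _⟩; linarith)]; ring
  · rw [if_neg (by linarith), if_neg (by linarith), if_pos ⟨by linarith, by linarith⟩,
      if_pos ⟨by linarith, by linarith⟩]; ring
  · linarith
  · linarith
  · rw [if_neg (by linarith), if_neg (by linarith), if_neg (by rintro ⟨_, _⟩; linarith),
      if_neg (by rintro ⟨_, _⟩; linarith)]; ring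

end

end SqTile

open SqTile Classical in
/-- For any tiling of a rectangle by n squares, there is a positive scaling factor making
all square side lengths integers, with the longest side of the rectangle at most 4^n. -/
theorem square_tiling_scaling_bound
    (a b c d : ℝ) (hab : a < b) (hcd : c < d)
    (n : ℕ) (x y s : Fin n → ℝ) (hs : ∀ i, 0 < s i)
    (hdisj : ∀ i j, i ≠ j →
      (Set.Ioo (x i) (x i + s i) ×ˢ Set.Ioo (y i) (y i + s i)) ∩
      (Set.Ioo (x j) (x j + s j) ×ˢ Set.Ioo (y j) (y j + s j)) = ∅)
    (hunion : (⋃ i, Set.Icc (x i) (x i + s i) ×ˢ Set.Icc (y i) (y i + s i))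
      = Set.Icc a b ×ˢ Set.Icc c d) :
    ∃ lam : ℝ, 0 < lam ∧ (∀ i, ∃ m : ℤ, lam * s i = m) ∧
      lam * max (b - a) (d - c) ≤ 4 ^ n := by
  have hbd := bounds hs hunion
  have hflow := flow hab hs hdisj hunion
  obtain ⟨T, hT⟩ : ∃ T : Finset ℝ, ∀ v, v ∈ T ↔ v ≠ c ∧ ∃ i, y i = v ∨ y i + s i = v := by
    refine ⟨(Finset.univ.image y ∪ Finset.univ.image (fun i => y i + s i)).erase c, fun v => ?_⟩
    simp [exists_or]
  have hTc : ∀ v ∈ T, c < v ∧ v ≤ d := by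
    intro v hv
    obtain ⟨h1, i, h2⟩ := (hT v).1 hv
    have := hbd i
    have := hs i
    rcases h2 with h2 | h2
    · exact ⟨lt_of_le_of_ne (by linarith) h1.symm, by linarith⟩
    · exact ⟨lt_of_le_of_ne (by linarith) h1.symm, by linarith⟩
  have hyT : ∀ i, y i ∉ T → y i = c := by
    intro i h; by_contra h'; exact h ((hT _).2 ⟨h', i, .inl rfl⟩)
  have hysT : ∀ i, y i + s i ∈ T := fun i =>
    (hT _).2 ⟨by linarith [hbd i, hs i, (hbd i).2.2.1] |> fun h : c < y i + s i => h.ne', i, .inr rfl⟩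
  -- incoming square
  have hin : ∀ u ∈ T, ∃ i, y i + s i = u := by
    intro u hu
    by_contra hno
    push Not at hno
    obtain ⟨h1, i, h2⟩ := (hT u).1 hu
    have hyi : y i = u := h2.resolve_right (hno i)
    have hf := hflow u (hTc u hu).1 (hTc u hu).2
    have : ∑ i, ((if y i + s i = u then (1:ℝ) else 0) - (if y i = u then 1 else 0)) * s i < 0 := by
      refine Finset.sum_neg' ?_ ⟨i, Finset.mem_univ _, ?_⟩
      · intro j _
        have := hs j
        rw [if_neg (hno j)]; split_ifs <;> linarith
      · have := hs i
        rw [if_neg (hno i), if_pos hyi]; linarith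
    rw [hf] at this
    split_ifs at this <;> linarith
  have hdT : d ∈ T := by
    by_contra hno
    have hf := hflow d hcd le_rfl
    have : ∑ i, ((if y i + s i = d then (1:ℝ) else 0) - (if y i = d then 1 else 0)) * s i = 0 := by
      refine Finset.sum_eq_zero fun i _ => ?_
      have hne : y i + s i ≠ d := fun h => hno (by rw [← h]; exact hysT i)
      rw [if_neg hne, if_neg]; · simp
      intro h; linarith [hbd i, hs i, (hbd i).2.2.2]
    rw [hf, if_pos rfl] at this
    linarith
  let B : T → Fin n → ℤ := fun v i =>
    (if y i + s i = v then 1 else 0) - (if y i = v then 1 else 0)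
  have hB2 : ∀ i, ∑ v, |B v i| ≤ 2 := by
    intro i
    calc ∑ v, |B v i| ≤ ∑ v : T, ((if y i + s i = v then (1:ℤ) else 0)
            + (if y i = v then 1 else 0)) := by
          refine Finset.sum_le_sum fun v _ => ?_
          simp only [B]
          split_ifs <;> simp
      _ ≤ 2 := by
          rw [Finset.sum_add_distrib,
            Finset.sum_coe_sort T (fun v => if y i + s i = v then (1:ℤ) else 0),
            Finset.sum_coe_sort T (fun v => if y i = v then (1:ℤ) else 0),
            Finset.sum_ite_eq, Finset.sum_ite_eq]
          split_ifs <;> simp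
  have hgrad : ∀ (Q : ℝ → ℝ), Q c = 0 → ∀ i,
      ∑ v : T, (B v i : ℝ) * Q v = Q (y i + s i) - Q (y i) := by
    intro Q hQ i
    have : ∀ v : T, (B v i : ℝ) * Q v = (if y i + s i = v then Q v else 0)
        - (if y i = v then Q v else 0) := by
      intro v; simp only [B]; push_cast; rw [sub_mul]; simp
    simp only [this]
    rw [Finset.sum_sub_distrib,
      Finset.sum_coe_sort T (fun v => if y i + s i = v then Q v else 0),
      Finset.sum_coe_sort T (fun v => if y i = v then Q v else 0),
      Finset.sum_ite_eq, Finset.sum_ite_eq, if_pos (hysT i)]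
    split_ifs with h
    · rfl
    · rw [hyT i h, hQ]
  let A : Matrix T T ℤ := Matrix.of fun u v => ∑ i, B u i * B v i
  have hA : ∀ u v, A u v = ∑ i, B u i * B v i := fun _ _ => rfl
  have hdet : A.det ≠ 0 := by
    intro h0
    obtain ⟨q, hq0, hq⟩ := Matrix.exists_mulVec_eq_zero_iff.2 h0
    have hen : ∑ i, (∑ v, B v i * q v) ^ 2 = 0 := by
      have : ∑ u, q u * (A.mulVec q) u = 0 := by simp [hq]
      rw [← this]
      simp only [Matrix.mulVec, dotProduct, hA, pow_two, Finset.sum_mul, Finset.mul_sum]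
      rw [Finset.sum_comm]
      refine Eq.trans ?_ (Finset.sum_congr rfl fun u _ => Finset.sum_comm)
      refine Finset.sum_congr rfl fun u _ => Finset.sum_congr rfl fun i _ =>
            Finset.sum_congr rfl fun v _ => ?_
      ring
    have hz : ∀ i, ∑ v, B v i * q v = 0 := by
      intro i
      have := (Finset.sum_eq_zero_iff_of_nonneg (fun i _ => sq_nonneg _)).1 hen i (Finset.mem_univ _)
      exact pow_eq_zero_iff (two_ne_zero) |>.1 this
    let Q : ℝ → ℝ := fun v => if h : v ∈ T then (q ⟨v, h⟩ : ℝ) else 0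
    have hcT : c ∉ T := fun h => ((hT c).1 h).1 rfl
    have hQc : Q c = 0 := by simp [Q, hcT]
    have hQe : ∀ i, Q (y i + s i) = Q (y i) := by
      intro i
      have h1 := hgrad Q hQc i
      have h2 : ∑ v : T, (B v i : ℝ) * Q v = ((∑ v, B v i * q v : ℤ) : ℝ) := by
        push_cast
        refine Finset.sum_congr rfl fun v _ => ?_
        simp [Q]
      rw [h2, hz i] at h1
      push_cast at h1; linarith
    have hQ0 : ∀ v ∈ T, Q v = 0 := by
      by_contra hne
      push Not at hne
      obtain ⟨v, hv, hvQ⟩ := hne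
      obtain ⟨w, hw, hmin⟩ := Finset.exists_min_image (T.filter (fun v => Q v ≠ 0)) id
        ⟨v, Finset.mem_filter.2 ⟨hv, hvQ⟩⟩
      obtain ⟨hwT, hwQ⟩ := Finset.mem_filter.1 hw
      obtain ⟨i, hi⟩ := hin w hwT
      have hQy : Q (y i) ≠ 0 := by rw [← hQe i, hi]; exact hwQ
      by_cases hy : y i ∈ T
      · have := hmin (y i) (Finset.mem_filter.2 ⟨hy, hQy⟩)
        simp only [id] at this
        linarith [hs i]
      · exact hQy (by rw [hyT i hy, hQc])
    apply hq0
    funext v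
    have := hQ0 v v.2
    simpa [Q] using this
  let D : T := ⟨d, hdT⟩
  let p : T → ℝ := fun v => (v : ℝ) - c
  let AR : Matrix T T ℝ := A.map (Int.castRingHom ℝ)
  have hAp : AR.mulVec p = Pi.single D (b - a) := by
    funext u
    have h1 : AR.mulVec p u = ∑ i, (B u i : ℝ) * ∑ v : T, (B v i : ℝ) * p v := by
      simp only [AR, Matrix.mulVec, dotProduct, Matrix.map_apply, hA, Finset.mul_sum]
      rw [Finset.sum_comm]
      refine Finset.sum_congr rfl fun v _ => ?_
      rw [map_sum, Finset.sum_mul]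
      refine Finset.sum_congr rfl fun v _ => ?_
      simp [mul_assoc]
    have h2 : ∀ i, ∑ v : T, (B v i : ℝ) * p v = s i := by
      intro i
      have := hgrad (fun v => v - c) (by simp) i
      simp only [p]
      rw [this]; ring
    rw [h1]
    simp only [h2]
    have h3 := hflow u (hTc u u.2).1 (hTc u u.2).2
    have h4 : (Pi.single D (b - a) : T → ℝ) u = if (u : ℝ) = d then b - a else 0 := by
      rw [Pi.single_apply]
      congr 1
      simp [D, Subtype.ext_iff]
    rw [h4, ← h3]
    refine Finset.sum_congr rfl fun i _ => ?_
    simp only [B]; push_cast; rfl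
  have hsol : ∀ u, (A.det : ℝ) * p u = (A.adjugate u D : ℝ) * (b - a) := by
    intro u
    have h1 : AR.adjugate.mulVec (AR.mulVec p) = AR.det • p := by
      rw [Matrix.mulVec_mulVec, Matrix.adjugate_mul, Matrix.smul_mulVec, Matrix.one_mulVec]
    rw [hAp] at h1
    have h2 := congrFun h1 u
    have h3 : AR.det = (A.det : ℝ) := by
      have := (Int.castRingHom ℝ).map_det A
      simpa [AR] using this.symm
    have h4 : AR.adjugate u D = (A.adjugate u D : ℝ) := by
      have := (Int.castRingHom ℝ).map_adjugate A
      have := congrFun (congrFun this u) D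
      simpa [AR] using this.symm
    rw [Matrix.mulVec_single] at h2
    simp [h3, h4] at h2
    linarith
  have hdetle : |A.det| ≤ 4 ^ n := det_bound B hB2 A (fun u => .inl (hA u))
  have hadjle : |A.adjugate D D| ≤ 4 ^ n := by
    rw [Matrix.adjugate_apply]
    refine det_bound B hB2 _ (fun u => ?_)
    by_cases hu : u = D
    · right
      subst hu
      simp [Matrix.updateRow_self, Pi.single_apply, apply_ite abs]
    · left
      intro v
      rw [Matrix.updateRow_ne hu, hA]
  have hW : 0 < b - a := by linarith
  have hDpos : (0:ℝ) < |(A.det : ℝ)| := abs_pos.2 (by exact_mod_cast hdet)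
  refine ⟨|(A.det : ℝ)| / (b - a), div_pos hDpos hW, ?_, ?_⟩
  · have hint : ∀ v : ℝ, (v ∈ T ∨ v = c) → ∃ m : ℤ, |(A.det : ℝ)| / (b - a) * (v - c) = m := by
      rintro v (hv | hv)
      · have h := hsol ⟨v, hv⟩
        simp only [p] at h
        rcases abs_choice (A.det : ℝ) with h' | h'
        · refine ⟨A.adjugate ⟨v, hv⟩ D, ?_⟩
          rw [h', div_mul_eq_mul_div, h, mul_div_cancel_right₀ _ hW.ne']
        · refine ⟨-A.adjugate ⟨v, hv⟩ D, ?_⟩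
          rw [h', div_mul_eq_mul_div, neg_mul, h, neg_div, mul_div_cancel_right₀ _ hW.ne']
          push_cast; rfl
      · exact ⟨0, by simp [hv]⟩
    intro i
    obtain ⟨m1, h1⟩ := hint _ (.inl (hysT i))
    obtain ⟨m2, h2⟩ := hint (y i) (by
      by_cases h : y i ∈ T
      · exact .inl h
      · exact .inr (hyT i h))
    refine ⟨m1 - m2, ?_⟩
    rw [Int.cast_sub, ← h1, ← h2]; ring
  · rw [mul_max_of_nonneg _ _ (div_pos hDpos hW).le]
    refine max_le ?_ ?_
    · rw [div_mul_cancel₀ _ hW.ne']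
      exact_mod_cast hdetle
    · have h := hsol D
      simp only [p, D] at h
      have h5 : |(A.det : ℝ)| * (d - c) = |(A.adjugate D D : ℝ)| * (b - a) := by
        have := congrArg abs h
        rwa [abs_mul, abs_mul, abs_of_pos hW, abs_of_pos (by linarith : 0 < d - c)] at this
      rw [div_mul_eq_mul_div, h5, mul_div_cancel_right₀ _ hW.ne']
      exact_mod_cast hadjle
end

section
/- Given a tiling of a rectangle by n rectangles with side-length ratios pᵢ/qᵢ (pᵢ, qᵢ positive integers, i = 1,…,n), there exists a positive scaling of the tiled rectangle such that all tiling rectangles have integer side lengths and the longest side of the scaled rectangle is at most 8^n · ∏_{i=1}^n max{pᵢ, qᵢ}. -/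
open Filter Topology in
lemma rt_cover {n : ℕ} (a b c d : ℝ) (l r e t : Fin n → ℝ)
    (hun : (⋃ i, Set.Icc (l i) (r i) ×ˢ Set.Icc (e i) (t i)) = Set.Icc a b ×ˢ Set.Icc c d)
    (s u : ℝ) (hs : a < s ∧ s ≤ b) (hu : c < u ∧ u ≤ d) :
    ∃ i, (l i < s ∧ s ≤ r i) ∧ (e i < u ∧ u ≤ t i) := by
  by_contra hcon
  push Not at hcon
  have key : ∀ (z k : ℝ), z < k → ∀ᶠ ε in 𝓝[>] (0:ℝ), z < k - ε := by
    intro z k hz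
    have : Set.Ioo (0:ℝ) (k - z) ∈ 𝓝[>] (0:ℝ) := Ioo_mem_nhdsGT (by linarith)
    filter_upwards [this] with ε hε
    linarith [hε.2]
  have pos : ∀ᶠ ε in 𝓝[>] (0:ℝ), 0 < ε := eventually_mem_nhdsWithin
  have h1 : ∀ᶠ ε in 𝓝[>] (0:ℝ), ∀ i,
      (s - ε, u - ε) ∉ Set.Icc (l i) (r i) ×ˢ Set.Icc (e i) (t i) := by
    rw [eventually_all]
    intro i
    by_cases c1 : l i < s
    · by_cases c2 : s ≤ r i
      · by_cases c3 : e i < u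
        · filter_upwards [key _ _ (hcon i ⟨c1, c2⟩ c3)] with ε hε hm
          exact absurd hm.2.2 (not_le.mpr hε)
        · filter_upwards [pos] with ε hε hm
          have := hm.2.1
          simp only at this
          linarith
      · filter_upwards [key _ _ (not_le.mp c2)] with ε hε hm
        exact absurd hm.1.2 (not_le.mpr hε)
    · filter_upwards [pos] with ε hε hm
      have := hm.1.1
      simp only at this
      linarith
  obtain ⟨ε, h1, h2, h3, h4⟩ := (h1.and (pos.and ((key a s hs.1).and (key c u hu.1)))).exists
  have : (s - ε, u - ε) ∈ Set.Icc a b ×ˢ Set.Icc c d :=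
    ⟨⟨h3.le, by simp only; linarith⟩, ⟨h4.le, by simp only; linarith⟩⟩
  rw [← hun, Set.mem_iUnion] at this
  obtain ⟨i, hi⟩ := this
  exact h1 i hi

lemma rt_uniq {l r e t l' r' e' t' s u : ℝ}
    (hd : (Set.Ioo l r ×ˢ Set.Ioo e t) ∩ (Set.Ioo l' r' ×ˢ Set.Ioo e' t') = ∅)
    (h1 : l < s ∧ s ≤ r) (h2 : e < u ∧ u ≤ t)
    (h3 : l' < s ∧ s ≤ r') (h4 : e' < u ∧ u ≤ t') : False := by
  obtain ⟨z, hz1, hz2⟩ := exists_between (max_lt h1.1 h3.1)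
  obtain ⟨k, hk1, hk2⟩ := exists_between (max_lt h2.1 h4.1)
  rw [max_lt_iff] at hz1 hk1
  have : (z, k) ∈ (Set.Ioo l r ×ˢ Set.Ioo e t) ∩ (Set.Ioo l' r' ×ˢ Set.Ioo e' t') :=
    ⟨⟨⟨hz1.1, hz2.trans_le h1.2⟩, ⟨hk1.1, hk2.trans_le h2.2⟩⟩,
      ⟨⟨hz1.2, hz2.trans_le h3.2⟩, ⟨hk1.2, hk2.trans_le h4.2⟩⟩⟩
  rw [hd] at this
  exact this

lemma rt_conn {n : ℕ} (a b c d : ℝ) (l r e t : Fin n → ℝ)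
    (hlr : ∀ i, l i < r i) (het : ∀ i, e i < t i)
    (hin : ∀ i, a ≤ l i ∧ r i ≤ b ∧ c ≤ e i ∧ t i ≤ d)
    (hcov : ∀ s u, (a < s ∧ s ≤ b) → (c < u ∧ u ≤ d) →
      ∃ i, (l i < s ∧ s ≤ r i) ∧ (e i < u ∧ u ≤ t i))
    (huniq : ∀ i j s u, (l i < s ∧ s ≤ r i) → (e i < u ∧ u ≤ t i) →
      (l j < s ∧ s ≤ r j) → (e j < u ∧ u ≤ t j) → i = j)
    (F : ℝ → ℝ) (h0 : F a = 0) (hF : ∀ i, F (r i) = F (l i)) : ∀ i, F (l i) = 0 := by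
  by_contra hne
  push Not at hne
  obtain ⟨i0, hi0⟩ := hne
  obtain ⟨i, him, hmin⟩ := Finset.exists_min_image (Finset.univ.filter fun i => F (l i) ≠ 0) l
    ⟨i0, by simpa using hi0⟩
  simp only [Finset.mem_filter, Finset.mem_univ, true_and] at him hmin
  have hne : a ≠ l i := fun h => him (h ▸ h0)
  have := hin i
  have h1 := hlr i
  have h2 := het i
  have ha : a < l i := lt_of_le_of_ne this.1 hne
  obtain ⟨j, hj1, hj2⟩ := hcov (l i) (t i) ⟨ha, by linarith⟩ ⟨by linarith, this.2.2.2⟩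
  rcases eq_or_lt_of_le hj1.2 with h | h
  · have h3 := hF j
    rw [← h] at h3
    have := hmin j (by rw [← h3]; exact him)
    linarith
  · have := huniq i j (min (r i) (r j)) (t i) ⟨lt_min h1 h, min_le_left _ _⟩ ⟨h2, le_rfl⟩
      ⟨lt_min (by linarith) (by linarith), min_le_right _ _⟩ hj2
    subst this
    linarith

lemma rt_step (S : Finset ℝ) (F : ℝ → ℝ) :
    ∃ α : ℝ → ℝ, ∃ k : ℝ, ∀ z ∈ S, F z = k + ∑ s ∈ S, if s ≤ z then α s else 0 := by
  induction S using Finset.induction_on_max with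
  | empty => exact ⟨0, 0, by simp⟩
  | insert m S hm ih =>
    obtain ⟨α, k, h⟩ := ih
    have hmS : m ∉ S := fun h => lt_irrefl _ (hm m h)
    refine ⟨Function.update α m (F m - k - ∑ s ∈ S, α s), k, ?_⟩
    have hcongr : ∀ z, (∑ s ∈ S, if s ≤ z then
        Function.update α m (F m - k - ∑ s ∈ S, α s) s else 0)
        = ∑ s ∈ S, if s ≤ z then α s else 0 := by
      intro z
      refine Finset.sum_congr rfl fun s hs => ?_
      rw [Function.update_of_ne (hm s hs).ne]
    intro z hz
    rw [Finset.sum_insert hmS, hcongr]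
    rcases Finset.mem_insert.mp hz with rfl | hz
    · have : (∑ s ∈ S, if s ≤ z then α s else 0) = ∑ s ∈ S, α s :=
        Finset.sum_congr rfl fun s hs => if_pos (hm s hs).le
      rw [this]
      simp
    · rw [if_neg (not_le.mpr (hm z hz)), h z hz]
      ring

lemma rt_step2 (S : Finset ℝ) (F : ℝ → ℝ) :
    ∃ α : ℝ → ℝ, ∀ z ∈ S, ∀ z' ∈ S, z ≤ z' →
      F z' - F z = ∑ s ∈ S, α s * (if z < s ∧ s ≤ z' then 1 else 0) := by
  obtain ⟨α, k, h⟩ := rt_step S F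
  refine ⟨α, fun z hz z' hz' hle => ?_⟩
  rw [h z hz, h z' hz', add_sub_add_left_eq_sub, ← Finset.sum_sub_distrib]
  refine Finset.sum_congr rfl fun s _ => ?_
  by_cases h1 : s ≤ z
  · simp [h1, h1.trans hle, not_lt.mpr h1]
  · simp [h1, not_le.mp h1]

lemma rt_area {n : ℕ} (a b c d : ℝ) (hab : a < b) (hcd : c < d) (l r e t : Fin n → ℝ)
    (hlr : ∀ i, l i < r i) (het : ∀ i, e i < t i)
    (hin : ∀ i, a ≤ l i ∧ r i ≤ b ∧ c ≤ e i ∧ t i ≤ d)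
    (hcov : ∀ s u, (a < s ∧ s ≤ b) → (c < u ∧ u ≤ d) →
      ∃ i, (l i < s ∧ s ≤ r i) ∧ (e i < u ∧ u ≤ t i))
    (huniq : ∀ i j s u, (l i < s ∧ s ≤ r i) → (e i < u ∧ u ≤ t i) →
      (l j < s ∧ s ≤ r j) → (e j < u ∧ u ≤ t j) → i = j)
    (X Y : Finset ℝ) (ha : a ∈ X) (hb : b ∈ X) (hc : c ∈ Y) (hd : d ∈ Y)
    (hl : ∀ i, l i ∈ X) (hr : ∀ i, r i ∈ X) (he : ∀ i, e i ∈ Y) (ht : ∀ i, t i ∈ Y)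
    (F G : ℝ → ℝ) :
    ∑ i, (F (r i) - F (l i)) * (G (t i) - G (e i)) = (F b - F a) * (G d - G c) := by
  obtain ⟨α, hα⟩ := rt_step2 X F
  obtain ⟨β, hβ⟩ := rt_step2 Y G
  rw [hα a ha b hb hab.le, hβ c hc d hd hcd.le, Finset.sum_mul_sum]
  have : ∀ i, (F (r i) - F (l i)) * (G (t i) - G (e i)) = ∑ s ∈ X, ∑ u ∈ Y,
      (α s * (if l i < s ∧ s ≤ r i then 1 else 0)) *
      (β u * (if e i < u ∧ u ≤ t i then 1 else 0)) := by
    intro i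
    rw [hα _ (hl i) _ (hr i) (hlr i).le, hβ _ (he i) _ (ht i) (het i).le, Finset.sum_mul_sum]
  simp_rw [this]
  rw [Finset.sum_comm]
  refine Finset.sum_congr rfl fun s _ => ?_
  rw [Finset.sum_comm]
  refine Finset.sum_congr rfl fun u _ => ?_
  by_cases h : (a < s ∧ s ≤ b) ∧ (c < u ∧ u ≤ d)
  · obtain ⟨j, hj1, hj2⟩ := hcov s u h.1 h.2
    rw [Finset.sum_eq_single j]
    · rw [if_pos hj1, if_pos hj2, if_pos h.1, if_pos h.2]
    · intro i _ hij
      by_cases h1 : l i < s ∧ s ≤ r i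
      · by_cases h2 : e i < u ∧ u ≤ t i
        · exact absurd (huniq i j s u h1 h2 hj1 hj2) hij
        · rw [if_neg h2]; ring
      · rw [if_neg h1]; ring
    · simp
  · have hR : (α s * (if a < s ∧ s ≤ b then (1:ℝ) else 0)) *
      (β u * (if c < u ∧ u ≤ d then 1 else 0)) = 0 := by
      by_cases h1 : a < s ∧ s ≤ b
      · rw [if_neg (fun h2 => h ⟨h1, h2⟩)]; ring
      · rw [if_neg h1]; ring
    rw [hR]
    refine Finset.sum_eq_zero fun i _ => ?_
    obtain ⟨k1, k2, k3, k4⟩ := hin i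
    by_cases h1 : l i < s ∧ s ≤ r i
    · by_cases h2 : e i < u ∧ u ≤ t i
      · exact absurd ⟨⟨by linarith, by linarith⟩, ⟨by linarith, by linarith⟩⟩ h
      · rw [if_neg h2]; ring
    · rw [if_neg h1]; ring

lemma rt_det {ι : Type*} [Fintype ι] [DecidableEq ι] (M : Matrix ι ι ℤ) :
    |M.det| ≤ ∏ i, ∑ j, |M i j| := by
  rw [← Matrix.det_transpose, Matrix.det_apply]
  refine (Finset.abs_sum_le_sum_abs _ _).trans ?_
  have h1 : ∀ σ : Equiv.Perm ι, |Equiv.Perm.sign σ • ∏ i, M.transpose (σ i) i|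
      = ∏ i, |M i (σ i)| := by
    intro σ
    rw [← Finset.abs_prod]
    rcases Int.units_eq_one_or (Equiv.Perm.sign σ) with h | h <;>
      simp [h, Matrix.transpose_apply]
  simp_rw [h1]
  rw [Finset.prod_univ_sum]
  rw [← Finset.sum_image (s := Finset.univ) (g := fun σ : Equiv.Perm ι => (σ : ι → ι))
    (f := fun f : ι → ι => ∏ i, |M i (f i)|)]
  · refine Finset.sum_le_sum_of_subset_of_nonneg ?_ ?_
    · intro f _; simp
    · intro f _ _
      exact Finset.prod_nonneg fun i _ => abs_nonneg _
  · intro σ _ τ _ h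
    exact DFunLike.coe_injective h

lemma rt_rows {ρ ι : Type} [Fintype ρ] [Fintype ι] [DecidableEq ι] (A : Matrix ρ ι ℤ)
    (hA : ∀ v : ι → ℝ, (A.map (Int.cast : ℤ → ℝ)).mulVec v = 0 → v = 0) :
    ∃ σ : ι → ρ, Function.Injective σ ∧ (A.submatrix σ id).det ≠ 0 := by
  set R := A.map (Int.cast : ℤ → ℝ) with hR
  have hinj : Function.Injective R.mulVec := by
    intro v v' h
    have : R.mulVec (v - v') = 0 := by rw [Matrix.mulVec_sub]; simpa [sub_eq_zero] using h
    exact sub_eq_zero.mp (hA _ this)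
  have hli := Matrix.mulVec_injective_iff.mp hinj
  have hrk : R.rank = Fintype.card ι := by
    rw [Matrix.rank_eq_finrank_span_cols]
    exact finrank_span_eq_card hli
  rw [Matrix.rank_eq_finrank_span_row] at hrk
  obtain ⟨κ, f, hf, hsp, hlin⟩ := exists_linearIndependent' ℝ R.row
  have : Finite κ := Finite.of_injective f hf
  have := Fintype.ofFinite κ
  have hc : Fintype.card κ = Fintype.card ι := by
    rw [← finrank_span_eq_card hlin, hsp, hrk]
  have eq := Fintype.equivOfCardEq hc.symm
  refine ⟨f ∘ eq, hf.comp eq.injective, ?_⟩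
  have h2 : LinearIndependent ℝ (R.submatrix (f ∘ eq) id).row := by
    have := hlin.comp eq eq.injective
    exact this
  rw [Matrix.linearIndependent_rows_iff_isUnit, Matrix.isUnit_iff_isUnit_det, isUnit_iff_ne_zero] at h2
  intro h0
  apply h2
  have : R.submatrix (f ∘ eq) id = (A.submatrix (f ∘ eq) id).map (Int.castRingHom ℝ) := rfl
  rw [this, ← RingHom.mapMatrix_apply, ← RingHom.map_det, h0, map_zero]

/-- main linear algebra lemma -/
lemma rt_main {ρ ι : Type} [Fintype ρ] [Fintype ι] [DecidableEq ι] (A : Matrix ρ ι ℤ)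
    (hA : ∀ v : ι → ℝ, (A.map (Int.cast : ℤ → ℝ)).mulVec v = 0 → v = 0)
    (v : ι → ℝ) (z : ρ → ℤ) (hv : (A.map (Int.cast : ℤ → ℝ)).mulVec v = fun i => (z i : ℝ))
    (K : ρ → ℤ) (hK : ∀ i, ∑ j, |A i j| + |z i| ≤ K i) (hK1 : ∀ i, 1 ≤ K i) :
    ∃ D : ℝ, 1 ≤ D ∧ D ≤ ∏ i, (K i : ℝ) ∧
      ∀ j, ∃ m : ℤ, D * v j = m ∧ D * v j ≤ ∏ i, (K i : ℝ) := by
  classical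
  obtain ⟨σ, hσ, hdet⟩ := rt_rows A hA
  set B := A.submatrix σ id with hB
  have hprod : ∏ j, K (σ j) ≤ ∏ i, K i := by
    rw [← Finset.prod_image (s := Finset.univ) (g := σ) (f := K) (fun i _ j _ h => hσ h)]
    rw [← Finset.prod_sdiff (Finset.subset_univ (Finset.univ.image σ))]
    refine le_mul_of_one_le_left ?_ ?_
    · exact Finset.prod_nonneg fun i _ => zero_le_one.trans (hK1 i)
    · exact Finset.prod_induction K (fun k => 1 ≤ k) (fun _ _ => one_le_mul_of_one_le_of_one_le)
        le_rfl (fun i _ => hK1 i)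
  have hDle : |B.det| ≤ ∏ i, K i := by
    refine (rt_det B).trans (le_trans (Finset.prod_le_prod ?_ ?_) hprod)
    · intro i _; positivity
    · intro i _
      have := hK (σ i)
      have h2 := abs_nonneg (z (σ i))
      simp only [hB, Matrix.submatrix_apply, id]
      linarith
  have hcr : ∀ j, |B.cramer (z ∘ σ) j| ≤ ∏ i, K i := by
    intro j
    rw [Matrix.cramer_apply]
    refine (rt_det _).trans (le_trans (Finset.prod_le_prod ?_ ?_) hprod)
    · intro i _; positivity
    · intro i _
      refine le_trans ?_ (hK (σ i))
      have : |z (σ i)| = ∑ k, if k = j then |z (σ i)| else 0 := by simp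
      rw [this, ← Finset.sum_add_distrib]
      refine Finset.sum_le_sum fun k _ => ?_
      rw [Matrix.updateCol_apply]
      split_ifs with h
      · simp
      · simp [hB]
  have hsol : ∀ j, (B.det : ℝ) * v j = (B.cramer (z ∘ σ) j : ℝ) := by
    have h1 : (B.map (Int.castRingHom ℝ)).mulVec v = fun j => ((z (σ j) : ℤ) : ℝ) := by
      funext j
      exact congrFun hv (σ j)
    have h2 := congrArg (B.map (Int.castRingHom ℝ)).adjugate.mulVec h1
    rw [Matrix.mulVec_mulVec, Matrix.adjugate_mul, Matrix.smul_mulVec, Matrix.one_mulVec] at h2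
    intro j
    have h3 := congrFun h2 j
    have h4 : (B.map (Int.castRingHom ℝ)).det = (B.det : ℝ) := by
      rw [← RingHom.mapMatrix_apply, ← RingHom.map_det]; rfl
    have h5 : (B.map (Int.castRingHom ℝ)).adjugate = B.adjugate.map (Int.castRingHom ℝ) := by
      rw [← RingHom.mapMatrix_apply, ← RingHom.map_adjugate]; rfl
    rw [h4, h5] at h3
    simp only [Pi.smul_apply, smul_eq_mul] at h3
    rw [h3, Matrix.cramer_eq_adjugate_mulVec]
    simp [Matrix.mulVec, dotProduct]
  refine ⟨((|B.det| : ℤ) : ℝ), ?_, ?_, ?_⟩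
  · exact_mod_cast Int.one_le_abs hdet
  · exact_mod_cast hDle
  · intro j
    have hb : |(B.det : ℝ) * v j| ≤ ∏ i, (K i : ℝ) := by
      rw [hsol]; exact_mod_cast hcr j
    rcases abs_choice B.det with h | h
    · refine ⟨B.cramer (z ∘ σ) j, ?_, ?_⟩
      · rw [h, hsol]
      · rw [h]; exact (le_abs_self _).trans hb
    · refine ⟨- B.cramer (z ∘ σ) j, ?_, ?_⟩
      · rw [h, Int.cast_neg, neg_mul, hsol, Int.cast_neg]
      · rw [h, Int.cast_neg, neg_mul]; exact (neg_le_abs _).trans hb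

/-- indicator row -/
noncomputable def rtδ (S : Finset ℝ) (z : ℝ) : S → ℤ := fun s => if s.1 = z then 1 else 0

lemma rtδ_abs (S : Finset ℝ) (z : ℝ) : ∑ s, |rtδ S z s| ≤ 1 := by
  have h1 : ∀ s, |rtδ S z s| = if s.1 = z then (1:ℤ) else 0 := by
    intro s; unfold rtδ; split_ifs <;> simp
  simp_rw [h1]
  rw [Finset.sum_coe_sort S (fun s => if s = z then (1:ℤ) else 0), Finset.sum_ite_eq']
  split_ifs <;> simp

open Classical in
/-- extension by zero -/
noncomputable def rtExt (S : Finset ℝ) (v : S → ℝ) : ℝ → ℝ :=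
  fun z => if h : z ∈ S then v ⟨z, h⟩ else 0

lemma rtδ_sum (S : Finset ℝ) (v : S → ℝ) (z : ℝ) :
    ∑ s, (rtδ S z s : ℝ) * v s = rtExt S v z := by
  classical
  unfold rtδ rtExt
  split_ifs with h
  · rw [Finset.sum_eq_single (⟨z, h⟩ : S)]
    · simp
    · intro s _ hs
      have : s.1 ≠ z := fun h' => hs (Subtype.ext h')
      simp [this]
    · simp
  · refine Finset.sum_eq_zero fun s _ => ?_
    have : s.1 ≠ z := fun h' => h (h' ▸ s.2)
    simp [this]

/-- the matrix -/
noncomputable def rtA {n : ℕ} (a b c : ℝ) (l r e t : Fin n → ℝ) (p q : Fin n → ℕ) (X Y : Finset ℝ) :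
    Matrix (Fin n ⊕ Fin 3) (X ⊕ Y) ℤ :=
  Sum.elim
    (fun i => Sum.elim (fun s => (p i : ℤ) * (rtδ X (r i) s - rtδ X (l i) s))
      (fun u => (q i : ℤ) * (rtδ Y (e i) u - rtδ Y (t i) u)))
    ![Sum.elim (rtδ X a) 0, Sum.elim 0 (rtδ Y c), Sum.elim (rtδ X b) 0]

lemma rtδ_abs2 (S : Finset ℝ) (k : ℕ) (z z' : ℝ) :
    ∑ s, |(k:ℤ) * (rtδ S z s - rtδ S z' s)| ≤ 2 * k := by
  have h1 := rtδ_abs S z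
  have h2 := rtδ_abs S z'
  calc _ ≤ ∑ s, (k:ℤ) * (|rtδ S z s| + |rtδ S z' s|) := by
        refine Finset.sum_le_sum fun s _ => ?_
        rw [abs_mul, Nat.abs_cast]
        exact mul_le_mul_of_nonneg_left (abs_sub _ _) (by positivity)
    _ ≤ _ := by
        rw [← Finset.mul_sum, Finset.sum_add_distrib]
        nlinarith [Int.natCast_nonneg k]

lemma rtδ_sum2 (S : Finset ℝ) (k : ℕ) (v : S → ℝ) (z z' : ℝ) :
    ∑ s, (((k:ℤ) * (rtδ S z s - rtδ S z' s) : ℤ) : ℝ) * v s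
      = k * (rtExt S v z - rtExt S v z') := by
  rw [← rtδ_sum, ← rtδ_sum, ← Finset.sum_sub_distrib, Finset.mul_sum]
  refine Finset.sum_congr rfl fun s _ => ?_
  push_cast; ring

section
variable {n : ℕ} (a b c : ℝ) (l r e t : Fin n → ℝ) (p q : Fin n → ℕ) (X Y : Finset ℝ)
  (v : X ⊕ Y → ℝ)

lemma rtA_tile (i : Fin n) : ((rtA a b c l r e t p q X Y).map (Int.cast : ℤ → ℝ)).mulVec v
    (Sum.inl i) = p i * (rtExt X (v ∘ Sum.inl) (r i) - rtExt X (v ∘ Sum.inl) (l i))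
      + q i * (rtExt Y (v ∘ Sum.inr) (e i) - rtExt Y (v ∘ Sum.inr) (t i)) := by
  rw [← rtδ_sum2, ← rtδ_sum2]
  simp only [Matrix.mulVec, dotProduct, Fintype.sum_sum_type]
  rfl

lemma rtA_0 : ((rtA a b c l r e t p q X Y).map (Int.cast : ℤ → ℝ)).mulVec v
    (Sum.inr 0) = rtExt X (v ∘ Sum.inl) a := by
  rw [← rtδ_sum]
  simp only [Matrix.mulVec, dotProduct, Fintype.sum_sum_type]
  refine (congrArg₂ (· + ·) rfl (Finset.sum_eq_zero fun u _ => ?_)).trans (add_zero _)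
  change ((0 : ℤ) : ℝ) * _ = 0
  simp

lemma rtA_1 : ((rtA a b c l r e t p q X Y).map (Int.cast : ℤ → ℝ)).mulVec v
    (Sum.inr 1) = rtExt Y (v ∘ Sum.inr) c := by
  rw [← rtδ_sum]
  simp only [Matrix.mulVec, dotProduct, Fintype.sum_sum_type]
  refine (congrArg₂ (· + ·) (Finset.sum_eq_zero fun u _ => ?_) rfl).trans (zero_add _)
  change ((0 : ℤ) : ℝ) * _ = 0
  simp

lemma rtA_2 : ((rtA a b c l r e t p q X Y).map (Int.cast : ℤ → ℝ)).mulVec v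
    (Sum.inr 2) = rtExt X (v ∘ Sum.inl) b := by
  rw [← rtδ_sum]
  simp only [Matrix.mulVec, dotProduct, Fintype.sum_sum_type]
  refine (congrArg₂ (· + ·) rfl (Finset.sum_eq_zero fun u _ => ?_)).trans (add_zero _)
  change ((0 : ℤ) : ℝ) * _ = 0
  simp
end

lemma rt_core {n : ℕ} (a b c d : ℝ) (hab : a < b) (hcd : c < d) (l r e t : Fin n → ℝ)
    (hlr : ∀ i, l i < r i) (het : ∀ i, e i < t i)
    (p q : Fin n → ℕ) (hp : ∀ i, 0 < p i) (hq : ∀ i, 0 < q i)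
    (hratio : ∀ i, (t i - e i) * q i = (r i - l i) * p i)
    (hin : ∀ i, a ≤ l i ∧ r i ≤ b ∧ c ≤ e i ∧ t i ≤ d)
    (hcov : ∀ s u, (a < s ∧ s ≤ b) → (c < u ∧ u ≤ d) →
      ∃ i, (l i < s ∧ s ≤ r i) ∧ (e i < u ∧ u ≤ t i))
    (huniq : ∀ i j s u, (l i < s ∧ s ≤ r i) → (e i < u ∧ u ≤ t i) →
      (l j < s ∧ s ≤ r j) → (e j < u ∧ u ≤ t j) → i = j) :
    ∃ lam : ℝ, 0 < lam ∧
      (∀ i, (∃ m : ℤ, lam * (r i - l i) = m) ∧ (∃ m : ℤ, lam * (t i - e i) = m)) ∧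
      lam * max (b - a) (d - c) ≤ 2 * ∏ i, (4 * max (p i : ℝ) (q i : ℝ)) := by
  classical
  let X : Finset ℝ := {a, b} ∪ (Finset.univ.image l ∪ Finset.univ.image r)
  let Y : Finset ℝ := {c, d} ∪ (Finset.univ.image e ∪ Finset.univ.image t)
  have ha : a ∈ X := by simp [X]
  have hb : b ∈ X := by simp [X]
  have hc : c ∈ Y := by simp [Y]
  have hd : d ∈ Y := by simp [Y]
  have hl : ∀ i, l i ∈ X := by simp [X]
  have hr : ∀ i, r i ∈ X := by simp [X]
  have he : ∀ i, e i ∈ Y := by simp [Y]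
  have ht : ∀ i, t i ∈ Y := by simp [Y]
  have hX : ∀ z ∈ X, z = a ∨ z = b ∨ (∃ i, l i = z) ∨ (∃ i, r i = z) := by
    intro z hz; simpa [X, or_assoc] using hz
  have hY : ∀ z ∈ Y, z = c ∨ z = d ∨ (∃ i, e i = z) ∨ (∃ i, t i = z) := by
    intro z hz; simpa [Y, or_assoc] using hz
  clear_value X Y
  have hinj : ∀ v : X ⊕ Y → ℝ,
      ((rtA a b c l r e t p q X Y).map (Int.cast : ℤ → ℝ)).mulVec v = 0 → v = 0 := by
    intro v hv
    have e1 := fun i => (rtA_tile a b c l r e t p q X Y v i).symm.trans (congrFun hv _)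
    have e2 := (rtA_0 a b c l r e t p q X Y v).symm.trans (congrFun hv _)
    have e3 := (rtA_1 a b c l r e t p q X Y v).symm.trans (congrFun hv _)
    have e4 := (rtA_2 a b c l r e t p q X Y v).symm.trans (congrFun hv _)
    have vX : ∀ s : X, v (Sum.inl s) = rtExt X (v ∘ Sum.inl) s.1 := by
      intro s; simp [rtExt]
    have vY : ∀ s : Y, v (Sum.inr s) = rtExt Y (v ∘ Sum.inr) s.1 := by
      intro s; simp [rtExt]
    generalize rtExt X (v ∘ Sum.inl) = F at *
    generalize rtExt Y (v ∘ Sum.inr) = G at *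
    simp only [Pi.zero_apply] at e1 e2 e3 e4
    have area := rt_area a b c d hab hcd l r e t hlr het hin hcov huniq X Y ha hb hc hd
      hl hr he ht F G
    rw [e2, e4, sub_self, zero_mul] at area
    have hpr : ∀ i, (0:ℝ) < p i := fun i => by exact_mod_cast hp i
    have hqr : ∀ i, (0:ℝ) < q i := fun i => by exact_mod_cast hq i
    have hG : ∀ i, G (t i) - G (e i) = p i / q i * (F (r i) - F (l i)) := by
      intro i
      have := hqr i
      field_simp
      linarith [e1 i]
    have hz := (Finset.sum_eq_zero_iff_of_nonneg (fun i _ => by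
      rw [hG i]
      have := div_pos (hpr i) (hqr i)
      nlinarith [mul_nonneg this.le (mul_self_nonneg (F (r i) - F (l i)))])).mp area
    have hF0 : ∀ i, F (r i) = F (l i) := by
      intro i
      have h := hz i (Finset.mem_univ i)
      rw [hG i] at h
      have := div_pos (hpr i) (hqr i)
      rcases mul_eq_zero.mp h with h | h
      · linarith
      · rcases mul_eq_zero.mp h with h | h
        · linarith
        · linarith
    have hG0 : ∀ i, G (t i) = G (e i) := by
      intro i
      have := hG i
      rw [hF0 i, sub_self, mul_zero] at this
      linarith
    have hFl := rt_conn a b c d l r e t hlr het hin hcov huniq F e2 hF0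
    have hGe := rt_conn c d a b e t l r het hlr
      (fun i => ⟨(hin i).2.2.1, (hin i).2.2.2, (hin i).1, (hin i).2.1⟩)
      (fun s u h1 h2 => (hcov u s h2 h1).imp fun i h => ⟨h.2, h.1⟩)
      (fun i j s u h1 h2 h3 h4 => huniq i j u s h2 h1 h4 h3) G e3 hG0
    have hGd : G d = 0 := by
      obtain ⟨i, hi1, hi2⟩ := hcov b d ⟨hab, le_rfl⟩ ⟨hcd, le_rfl⟩
      have : d = t i := le_antisymm hi2.2 (hin i).2.2.2
      rw [this, hG0, hGe]
    funext k
    rcases k with s | u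
    · rw [vX]
      rcases hX s.1 s.2 with h | h | ⟨i, h⟩ | ⟨i, h⟩
      · rw [h, e2]; rfl
      · rw [h, e4]; rfl
      · rw [← h, hFl]; rfl
      · rw [← h, hF0, hFl]; rfl
    · rw [vY]
      rcases hY u.1 u.2 with h | h | ⟨i, h⟩ | ⟨i, h⟩
      · rw [h, e3]; rfl
      · rw [h, hGd]; rfl
      · rw [← h, hGe]; rfl
      · rw [← h, hG0, hGe]; rfl
  have hba : 0 < b - a := by linarith
  let v : X ⊕ Y → ℝ := Sum.elim (fun s => (s.1 - a) / (b - a)) (fun u => (u.1 - c) / (b - a))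
  have vX : ∀ s ∈ X, rtExt X (v ∘ Sum.inl) s = (s - a) / (b - a) := by
    intro s hs; simp [rtExt, hs, v]
  have vY : ∀ s ∈ Y, rtExt Y (v ∘ Sum.inr) s = (s - c) / (b - a) := by
    intro s hs; simp [rtExt, hs, v]
  obtain ⟨D, hD1, hD2, hD⟩ := rt_main (rtA a b c l r e t p q X Y) hinj v
    (Sum.elim 0 ![0, 0, 1])
    (by
      funext k
      rcases k with i | k
      · rw [rtA_tile, vX _ (hl i), vX _ (hr i), vY _ (he i), vY _ (ht i)]
        simp only [Sum.elim_inl, Pi.zero_apply, Int.cast_zero]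
        field_simp
        linarith [hratio i]
      · fin_cases k
        · refine (rtA_0 ..).trans ?_
          rw [vX _ ha]; simp
        · refine (rtA_1 ..).trans ?_
          rw [vY _ hc]; simp
        · refine (rtA_2 ..).trans ?_
          rw [vX _ hb]; simp [hba.ne'])
    (Sum.elim (fun i => 4 * max (p i : ℤ) (q i)) ![1, 1, 2])
    (by
      intro k
      rcases k with i | k
      · have h1 := rtδ_abs2 X (p i) (r i) (l i)
        have h2 := rtδ_abs2 Y (q i) (e i) (t i)
        have h3 := le_max_left (p i : ℤ) (q i)
        have h4 := le_max_right (p i : ℤ) (q i)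
        simp only [Fintype.sum_sum_type, rtA, Sum.elim_inl, Sum.elim_inr, Pi.zero_apply, abs_zero]
        linarith
      · have h1 := rtδ_abs X a
        have h2 := rtδ_abs Y c
        have h3 := rtδ_abs X b
        fin_cases k
        · simpa [Fintype.sum_sum_type, rtA] using h1
        · simpa [Fintype.sum_sum_type, rtA] using h2
        · simp only [Finset.univ_eq_attach] at h3
          simp [Fintype.sum_sum_type, rtA]
          linarith)
    (by
      intro k
      rcases k with i | k
      · have h3 := le_max_left (p i : ℤ) (q i)
        have := hp i
        simp only [Sum.elim_inl]
        omega
      · fin_cases k <;> simp)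
  have hprod : ∏ k, ((Sum.elim (fun i => 4 * max (p i : ℤ) (q i)) ![1, 1, 2] :
      Fin n ⊕ Fin 3 → ℤ) k : ℝ) = 2 * ∏ i, (4 * max (p i : ℝ) (q i : ℝ)) := by
    rw [Fintype.prod_sum_type, Fin.prod_univ_three]
    simp [mul_comm]
  rw [hprod] at hD2 hD
  have hlam : ∀ s, D / (b - a) * s = D * (s / (b - a)) := fun s => by ring
  refine ⟨D / (b - a), by positivity, ?_, ?_⟩
  · intro i
    obtain ⟨m1, h1, -⟩ := hD (Sum.inl ⟨_, hl i⟩)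
    obtain ⟨m2, h2, -⟩ := hD (Sum.inl ⟨_, hr i⟩)
    obtain ⟨m3, h3, -⟩ := hD (Sum.inr ⟨_, he i⟩)
    obtain ⟨m4, h4, -⟩ := hD (Sum.inr ⟨_, ht i⟩)
    simp only [v, Sum.elim_inl, Sum.elim_inr] at h1 h2 h3 h4
    refine ⟨⟨m2 - m1, ?_⟩, ⟨m4 - m3, ?_⟩⟩
    · push_cast; rw [← h1, ← h2]; ring
    · push_cast; rw [← h3, ← h4]; ring
  · rw [mul_max_of_nonneg _ _ (by positivity)]
    refine max_le ?_ ?_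
    · rw [div_mul_cancel₀ _ hba.ne']; exact hD2
    · obtain ⟨m, -, h⟩ := hD (Sum.inr ⟨_, hd⟩)
      rw [hlam]; exact h



/-- For any tiling of a rectangle by n rectangles with side ratios pᵢ/qᵢ, there is a
positive scaling making all tile side lengths integers, with the longest side of the
scaled rectangle at most 8^n · ∏ max{pᵢ,qᵢ}. -/
theorem rect_tiling_by_rects_scaling_bound
    (a b c d : ℝ) (hab : a < b) (hcd : c < d)
    (n : ℕ) (x y w h : Fin n → ℝ) (hw : ∀ i, 0 < w i) (hh : ∀ i, 0 < h i)
    (p q : Fin n → ℕ) (hp : ∀ i, 0 < p i) (hq : ∀ i, 0 < q i)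
    (hratio : ∀ i, h i * q i = w i * p i)
    (hdisj : ∀ i j, i ≠ j →
      (Set.Ioo (x i) (x i + w i) ×ˢ Set.Ioo (y i) (y i + h i)) ∩
      (Set.Ioo (x j) (x j + w j) ×ˢ Set.Ioo (y j) (y j + h j)) = ∅)
    (hunion : (⋃ i, Set.Icc (x i) (x i + w i) ×ˢ Set.Icc (y i) (y i + h i))
      = Set.Icc a b ×ˢ Set.Icc c d) :
    ∃ lam : ℝ, 0 < lam ∧
      (∀ i, (∃ m : ℤ, lam * w i = m) ∧ (∃ m : ℤ, lam * h i = m)) ∧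
      lam * max (b - a) (d - c) ≤ 8 ^ n * ∏ i, (max (p i) (q i) : ℝ) := by
  have hin : ∀ i, a ≤ x i ∧ x i + w i ≤ b ∧ c ≤ y i ∧ y i + h i ≤ d := by
    intro i
    have h1 : (x i, y i) ∈ Set.Icc a b ×ˢ Set.Icc c d := by
      rw [← hunion, Set.mem_iUnion]
      exact ⟨i, ⟨le_rfl, by simp [(hw i).le]⟩, ⟨le_rfl, by simp [(hh i).le]⟩⟩
    have h2 : (x i + w i, y i + h i) ∈ Set.Icc a b ×ˢ Set.Icc c d := by
      rw [← hunion, Set.mem_iUnion]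
      exact ⟨i, ⟨by simp [(hw i).le], le_rfl⟩, ⟨by simp [(hh i).le], le_rfl⟩⟩
    exact ⟨h1.1.1, h2.1.2, h1.2.1, h2.2.2⟩
  have hcov := rt_cover a b c d x (fun i => x i + w i) y (fun i => y i + h i) hunion
  have hn : 1 ≤ n := by
    obtain ⟨i, -⟩ := hcov b d ⟨hab, le_rfl⟩ ⟨hcd, le_rfl⟩
    have := i.2
    omega
  obtain ⟨lam, h1, h2, h3⟩ := rt_core a b c d hab hcd x (fun i => x i + w i) y
    (fun i => y i + h i) (fun i => by simp [hw i]) (fun i => by simp [hh i]) p q hp hq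
    (fun i => by simpa using hratio i) hin hcov
    (fun i j s u k1 k2 k3 k4 => by
      by_contra hij
      exact rt_uniq (hdisj i j hij) k1 k2 k3 k4)
  refine ⟨lam, h1, fun i => by simpa using h2 i, h3.trans ?_⟩
  rw [Finset.prod_mul_distrib, ← mul_assoc]
  refine mul_le_mul_of_nonneg_right ?_ (Finset.prod_nonneg fun i _ => by positivity)
  simp only [Finset.prod_const, Finset.card_univ, Fintype.card_fin]
  have h8 : (8:ℝ) ^ n = 2 ^ n * 4 ^ n := by rw [← mul_pow]; norm_num
  rw [h8]
  have : (2:ℝ) ^ 1 ≤ 2 ^ n := pow_le_pow_right₀ (by norm_num) hn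
  rw [pow_one] at this
  exact mul_le_mul_of_nonneg_right this (by positivity)
end

section
/- For any tiling of an equilateral triangle by n equilateral triangles, there exists a positive scaling of the tiled triangle such that all triangular tiles have integer side lengths and the side length of the scaled triangle is at most 4^{(2n−2)/3}. -/
/-- Oblique coordinate map: Ψ(a,b) = a·(1,0) + b·(1/2, √3/2). -/
noncomputable def Psi (a b : ℝ) : ℝ × ℝ := (a + b / 2, Real.sqrt 3 * b / 2)

/-- T(a,b,c): the equilateral triangle with vertices Ψ(a,b), Ψ(a+c,b), Ψ(a,b+c). -/
noncomputable def Tri (a b c : ℝ) : Set (ℝ × ℝ) :=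
  convexHull ℝ {Psi a b, Psi (a + c) b, Psi a (b + c)}

noncomputable def cy (p : ℝ × ℝ) : ℝ := 2 * p.2 / Real.sqrt 3
noncomputable def cx (p : ℝ × ℝ) : ℝ := p.1 - p.2 / Real.sqrt 3

lemma cy_Psi (x y : ℝ) : cy (Psi x y) = y := by
  have : Real.sqrt 3 ≠ 0 := by positivity
  simp only [cy, Psi]; field_simp

lemma cx_Psi (x y : ℝ) : cx (Psi x y) = x := by
  have : Real.sqrt 3 ≠ 0 := by positivity
  simp only [cx, Psi]; field_simp; ring

lemma Psi_cx_cy (p : ℝ × ℝ) : Psi (cx p) (cy p) = p := by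
  have : Real.sqrt 3 ≠ 0 := by positivity
  ext
  · simp only [cx, cy, Psi]; field_simp; ring
  · simp only [cx, cy, Psi]; field_simp

lemma cx_comb (p q : ℝ × ℝ) (s t : ℝ) : cx (s • p + t • q) = s * cx p + t * cx q := by
  simp only [cx, Prod.fst_add, Prod.snd_add, Prod.smul_fst, Prod.smul_snd, smul_eq_mul]; ring

lemma cy_comb (p q : ℝ × ℝ) (s t : ℝ) : cy (s • p + t • q) = s * cy p + t * cy q := by
  simp only [cy, Prod.snd_add, Prod.smul_snd, smul_eq_mul]; ring

lemma cx_cont : Continuous cx := by unfold cx; fun_prop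
lemma cy_cont : Continuous cy := by unfold cy; fun_prop

lemma Tri_eq (a b c : ℝ) (hc : c ≠ 0) : Tri a b c =
    {p | 0 ≤ (cx p - a) * c ∧ 0 ≤ (cy p - b) * c ∧ (cx p + cy p - a - b) * c ≤ c * c} := by
  have hcc : 0 < c * c := mul_self_pos.2 hc
  apply Set.Subset.antisymm
  · apply convexHull_min
    · intro p hp
      simp only [Set.mem_insert_iff, Set.mem_singleton_iff] at hp
      rcases hp with rfl | rfl | rfl <;>
        simp only [Set.mem_ofPred_eq, cx_Psi, cy_Psi] <;> refine ⟨?_, ?_, ?_⟩ <;> nlinarith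
    · intro p hp q hq s t hs ht hst
      simp only [Set.mem_ofPred_eq] at hp hq ⊢
      rw [cx_comb, cy_comb]
      obtain rfl : t = 1 - s := by linarith
      obtain ⟨h1, h2, h3⟩ := hp
      obtain ⟨k1, k2, k3⟩ := hq
      have a1 := mul_nonneg hs h1
      have a2 := mul_nonneg hs h2
      have a3 := mul_nonneg hs (sub_nonneg.2 h3)
      have b1 := mul_nonneg ht k1
      have b2 := mul_nonneg ht k2
      have b3 := mul_nonneg ht (sub_nonneg.2 k3)
      refine ⟨?_, ?_, ?_⟩ <;> linarith
  · rintro p ⟨h1, h2, h3⟩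
    have hu : 0 ≤ (cx p - a) / c := by
      rw [show (cx p - a) / c = (cx p - a) * c / (c * c) by field_simp]; positivity
    have hv : 0 ≤ (cy p - b) / c := by
      rw [show (cy p - b) / c = (cy p - b) * c / (c * c) by field_simp]; positivity
    have hw : 0 ≤ 1 - (cx p - a) / c - (cy p - b) / c := by
      rw [show 1 - (cx p - a) / c - (cy p - b) / c
        = (c * c - (cx p + cy p - a - b) * c) / (c * c) by field_simp; ring]
      exact div_nonneg (by linarith) hcc.le
    have hconv : Convex ℝ (Tri a b c) := convex_convexHull _ _
    have m1 : Psi a b ∈ Tri a b c := subset_convexHull _ _ (by simp)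
    have m2 : Psi (a + c) b ∈ Tri a b c := subset_convexHull _ _ (by simp)
    have m3 : Psi a (b + c) ∈ Tri a b c := subset_convexHull _ _ (by simp)
    have key := hconv.sum_mem (t := Finset.univ)
      (w := ![1 - (cx p - a) / c - (cy p - b) / c, (cx p - a) / c, (cy p - b) / c])
      (z := ![Psi a b, Psi (a + c) b, Psi a (b + c)])
      (by intro i _; fin_cases i <;> simp <;> linarith)
      (by simp only [Fin.sum_univ_three, Matrix.cons_val]; ring)
      (by intro i _; fin_cases i <;> simp [m1, m2, m3])
    convert key using 1
    rw [Fin.sum_univ_three]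
    conv_lhs => rw [← Psi_cx_cy p]
    ext <;> simp [Psi] <;> field_simp <;> ring

lemma mem_Tri_pos {a b c x y : ℝ} (hc : 0 < c) :
    Psi x y ∈ Tri a b c ↔ a ≤ x ∧ b ≤ y ∧ x + y ≤ a + b + c := by
  rw [Tri_eq _ _ _ hc.ne']
  simp only [Set.mem_ofPred_eq, cx_Psi, cy_Psi]
  rw [mul_nonneg_iff_of_pos_right hc, mul_nonneg_iff_of_pos_right hc, mul_le_mul_iff_left₀ hc]
  constructor <;> rintro ⟨h1, h2, h3⟩ <;> refine ⟨?_, ?_, ?_⟩ <;> linarith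

lemma mem_Tri_neg {a b c x y : ℝ} (hc : c < 0) :
    Psi x y ∈ Tri a b c ↔ x ≤ a ∧ y ≤ b ∧ a + b + c ≤ x + y := by
  rw [Tri_eq _ _ _ hc.ne]
  simp only [Set.mem_ofPred_eq, cx_Psi, cy_Psi]
  constructor
  · rintro ⟨h1, h2, h3⟩; refine ⟨?_, ?_, ?_⟩ <;> nlinarith
  · rintro ⟨h1, h2, h3⟩; refine ⟨?_, ?_, ?_⟩ <;> nlinarith

lemma mem_int {a b c x y : ℝ} (hc : c ≠ 0) (h1 : 0 < (x - a) * c) (h2 : 0 < (y - b) * c)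
    (h3 : (x + y - a - b) * c < c * c) : Psi x y ∈ interior (Tri a b c) := by
  have hx := cx_cont
  have hy := cy_cont
  have ho : IsOpen {p : ℝ × ℝ | 0 < (cx p - a) * c ∧ 0 < (cy p - b) * c ∧
      (cx p + cy p - a - b) * c < c * c} := by
    have o1 : IsOpen {p : ℝ × ℝ | 0 < (cx p - a) * c} := isOpen_lt (by fun_prop) (by fun_prop)
    have o2 : IsOpen {p : ℝ × ℝ | 0 < (cy p - b) * c} := isOpen_lt (by fun_prop) (by fun_prop)
    have o3 : IsOpen {p : ℝ × ℝ | (cx p + cy p - a - b) * c < c * c} :=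
      isOpen_lt (by fun_prop) (by fun_prop)
    exact o1.inter (o2.inter o3)
  refine interior_maximal ?_ ho ?_
  · rw [Tri_eq _ _ _ hc]
    rintro p ⟨k1, k2, k3⟩
    exact ⟨k1.le, k2.le, k3.le⟩
  · simp only [Set.mem_ofPred_eq, cx_Psi, cy_Psi]
    exact ⟨h1, h2, h3⟩

/-- length of the horizontal slice at a generic height -/
noncomputable def FF (b c t : ℝ) : ℝ :=
  if b < t ∧ t < b + c then b + c - t else if b + c < t ∧ t < b then t - (b + c) else 0

lemma FF_nonneg (b c t : ℝ) : 0 ≤ FF b c t := by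
  unfold FF; split_ifs with h1 h2 <;> linarith

open MeasureTheory in
lemma slice_closed {a b c t : ℝ} (hc : c ≠ 0) (h1 : t ≠ b) (h2 : t ≠ b + c) :
    volume {x | Psi x t ∈ Tri a b c} = ENNReal.ofReal (FF b c t) := by
  unfold FF
  rcases lt_or_gt_of_ne hc with h | h
  · simp only [mem_Tri_neg h]
    split_ifs with k1 k2
    · linarith
    · have : {x | x ≤ a ∧ t ≤ b ∧ a + b + c ≤ x + t} = Set.Icc (a + b + c - t) a := by
        ext x; simp only [Set.mem_ofPred_eq, Set.mem_Icc]
        constructor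
        · rintro ⟨_, _, _⟩; constructor <;> linarith
        · rintro ⟨_, _⟩; refine ⟨?_, ?_, ?_⟩ <;> linarith
      rw [this, Real.volume_Icc]; congr 1; ring
    · have : {x | x ≤ a ∧ t ≤ b ∧ a + b + c ≤ x + t} = ∅ := by
        ext x; simp only [Set.mem_ofPred_eq, Set.mem_empty_iff_false, iff_false]
        rintro ⟨_, e2, _⟩
        exact k2 ⟨lt_of_le_of_ne (by linarith) h2.symm, lt_of_le_of_ne e2 h1⟩
      rw [this]; simp
  · simp only [mem_Tri_pos h]
    split_ifs with k1 k2
    · have : {x | a ≤ x ∧ b ≤ t ∧ x + t ≤ a + b + c} = Set.Icc a (a + b + c - t) := by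
        ext x; simp only [Set.mem_ofPred_eq, Set.mem_Icc]
        constructor
        · rintro ⟨_, _, _⟩; constructor <;> linarith
        · rintro ⟨_, _⟩; refine ⟨?_, ?_, ?_⟩ <;> linarith
      rw [this, Real.volume_Icc]; congr 1; ring
    · linarith
    · have : {x | a ≤ x ∧ b ≤ t ∧ x + t ≤ a + b + c} = ∅ := by
        ext x; simp only [Set.mem_ofPred_eq, Set.mem_empty_iff_false, iff_false]
        rintro ⟨_, e2, _⟩
        exact k1 ⟨lt_of_le_of_ne e2 h1.symm, lt_of_le_of_ne (by linarith) h2⟩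
      rw [this]; simp

open MeasureTheory in
lemma slice_open (a b c t : ℝ) (hc : c ≠ 0) :
    ∃ I : Set ℝ, MeasurableSet I ∧ volume I = ENNReal.ofReal (FF b c t) ∧
      ∀ x ∈ I, Psi x t ∈ interior (Tri a b c) := by
  unfold FF
  split_ifs with k1 k2
  · refine ⟨Set.Ioo a (a + b + c - t), measurableSet_Ioo, ?_, ?_⟩
    · rw [Real.volume_Ioo]; congr 1; ring
    · rintro x ⟨e1, e2⟩
      apply mem_int hc <;> nlinarith
  · refine ⟨Set.Ioo (a + b + c - t) a, measurableSet_Ioo, ?_, ?_⟩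
    · rw [Real.volume_Ioo]; congr 1; ring
    · rintro x ⟨e1, e2⟩
      apply mem_int hc <;> nlinarith
  · exact ⟨∅, MeasurableSet.empty, by simp, by simp⟩

open MeasureTheory in
lemma slice_sum (A B C : ℝ) (hC : 0 < C)
    (n : ℕ) (a b c : Fin n → ℝ) (hc : ∀ i, c i ≠ 0)
    (hdisj : ∀ i j, i ≠ j →
      interior (Tri (a i) (b i) (c i)) ∩ interior (Tri (a j) (b j) (c j)) = ∅)
    (hunion : (⋃ i, Tri (a i) (b i) (c i)) = Tri A B C) (t : ℝ)
    (h1 : ∀ i, t ≠ b i) (h2 : ∀ i, t ≠ b i + c i) (h3 : t ≠ B) (h4 : t ≠ B + C) :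
    ∑ i, FF (b i) (c i) t = FF B C t := by
  have hJ : {x | Psi x t ∈ Tri A B C} = ⋃ i, {x | Psi x t ∈ Tri (a i) (b i) (c i)} := by
    rw [← hunion]; ext x; simp
  have hsum : ∑ i, ENNReal.ofReal (FF (b i) (c i) t) = ENNReal.ofReal (FF B C t) := by
    apply le_antisymm
    · choose I hm hv hI using fun i => slice_open (a i) (b i) (c i) t (hc i)
      have : volume (⋃ i, I i) = ∑ i, volume (I i) := by
        rw [measure_iUnion ?_ hm, tsum_fintype]
        intro i j hij
        rw [Function.onFun, Set.disjoint_left]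
        intro x hx hx'
        have : Psi x t ∈ (∅ : Set (ℝ × ℝ)) := by
          rw [← hdisj i j hij]; exact ⟨hI i x hx, hI j x hx'⟩
        exact this
      simp only [hv] at this
      rw [← this, ← slice_closed (a := A) hC.ne' h3 h4, hJ]
      apply measure_mono
      apply Set.iUnion_mono
      intro i x hx
      exact (interior_subset (hI i x hx) : Psi x t ∈ Tri (a i) (b i) (c i))
    · rw [← slice_closed (a := A) hC.ne' h3 h4, hJ]
      refine (measure_iUnion_fintype_le _ _).trans (le_of_eq ?_)
      apply Finset.sum_congr rfl
      intro i _
      exact slice_closed (hc i) (h1 i) (h2 i)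
  rw [← ENNReal.ofReal_sum_of_nonneg (fun i _ => FF_nonneg _ _ _)] at hsum
  exact (ENNReal.ofReal_eq_ofReal_iff (Finset.sum_nonneg fun i _ => FF_nonneg _ _ _)
    (FF_nonneg _ _ _)).1 hsum

lemma FF_right {b c h d t : ℝ} (h1 : b = h ∨ 2 * d < |b - h|)
    (h2 : b + c = h ∨ 2 * d < |b + c - h|) (ht : h < t) (ht' : t ≤ h + 2 * d) :
    FF b c t = if b ≤ h ∧ h < b + c then b + c - t else
      if b + c ≤ h ∧ h < b then t - (b + c) else 0 := by
  rw [lt_abs] at h1 h2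
  have e1 : b < t ↔ b ≤ h := by
    constructor <;> intro k <;> rcases h1 with h1 | h1 | h1 <;> linarith
  have e2 : b + c < t ↔ b + c ≤ h := by
    constructor <;> intro k <;> rcases h2 with h2 | h2 | h2 <;> linarith
  have e3 : t < b ↔ h < b := by
    constructor <;> intro k <;> rcases h1 with h1 | h1 | h1 <;> linarith
  have e4 : t < b + c ↔ h < b + c := by
    constructor <;> intro k <;> rcases h2 with h2 | h2 | h2 <;> linarith
  simp only [FF, e1, e2, e3, e4]

lemma FF_left {b c h d t : ℝ} (h1 : b = h ∨ 2 * d < |b - h|)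
    (h2 : b + c = h ∨ 2 * d < |b + c - h|) (ht : t < h) (ht' : h - 2 * d ≤ t) :
    FF b c t = if b < h ∧ h ≤ b + c then b + c - t else
      if b + c < h ∧ h ≤ b then t - (b + c) else 0 := by
  rw [lt_abs] at h1 h2
  have e1 : b < t ↔ b < h := by
    constructor <;> intro k <;> rcases h1 with h1 | h1 | h1 <;> linarith
  have e2 : b + c < t ↔ b + c < h := by
    constructor <;> intro k <;> rcases h2 with h2 | h2 | h2 <;> linarith
  have e3 : t < b ↔ h ≤ b := by
    constructor <;> intro k <;> rcases h1 with h1 | h1 | h1 <;> linarith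
  have e4 : t < b + c ↔ h ≤ b + c := by
    constructor <;> intro k <;> rcases h2 with h2 | h2 | h2 <;> linarith
  simp only [FF, e1, e2, e3, e4]

lemma tri3 (b h : ℝ) :
    ((b < h) = True ∧ (b ≤ h) = True ∧ (h < b) = False ∧ (h ≤ b) = False ∧ (b = h) = False) ∨
    ((b < h) = False ∧ (b ≤ h) = True ∧ (h < b) = False ∧ (h ≤ b) = True ∧ (b = h) = True) ∨
    ((b < h) = False ∧ (b ≤ h) = False ∧ (h < b) = True ∧ (h ≤ b) = True ∧ (b = h) = False) := by
  rcases lt_trichotomy b h with k | k | k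
  · left; simp [k, k.le, k.ne, k.not_gt]
  · right; left; simp [k]
  · right; right; simp [k, k.le, k.ne', k.not_gt]

lemma FF_jump {b c h d : ℝ} (hc : c ≠ 0) (hd : 0 < d) (h1 : b = h ∨ 2 * d < |b - h|)
    (h2 : b + c = h ∨ 2 * d < |b + c - h|) :
    (2 * FF b c (h + d) - FF b c (h + 2 * d)) - (2 * FF b c (h - d) - FF b c (h - 2 * d))
      = if b = h then c else 0 := by
  rw [FF_right (d := d) h1 h2 (t := h + d) (by linarith) (by linarith),
    FF_right (d := d) h1 h2 (t := h + 2 * d) (by linarith) (by linarith),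
    FF_left (d := d) h1 h2 (t := h - d) (by linarith) (by linarith),
    FF_left (d := d) h1 h2 (t := h - 2 * d) (by linarith) (by linarith)]
  clear h1 h2
  rcases tri3 b h with ⟨k1, k2, k3, k4, k5⟩ | ⟨k1, k2, k3, k4, k5⟩ | ⟨k1, k2, k3, k4, k5⟩ <;>
    rcases tri3 (b + c) h with ⟨l1, l2, l3, l4, l5⟩ | ⟨l1, l2, l3, l4, l5⟩ | ⟨l1, l2, l3, l4, l5⟩ <;>
    simp only [k1, k2, k3, k4, k5, l1, l2, l3, l4, l5, and_self, and_true, true_and, and_false,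
      false_and, if_true, if_false] <;>
    first
    | linarith
    | exact absurd (by linarith [of_eq_true k5, of_eq_true l5]) hc
    | linarith [of_eq_true k5]
    | linarith [of_eq_true l5]

lemma FF_slope {b c h d : ℝ} (hc : c ≠ 0) (hd : 0 < d) (h1 : b = h ∨ 2 * d < |b - h|)
    (h2 : b + c = h ∨ 2 * d < |b + c - h|) :
    (FF b c (h + 2 * d) - FF b c (h + d)) - (FF b c (h - d) - FF b c (h - 2 * d))
      = d * ((if b + c = h then 1 else 0) - (if b = h then 1 else 0)) := by
  rw [FF_right (d := d) h1 h2 (t := h + d) (by linarith) (by linarith),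
    FF_right (d := d) h1 h2 (t := h + 2 * d) (by linarith) (by linarith),
    FF_left (d := d) h1 h2 (t := h - d) (by linarith) (by linarith),
    FF_left (d := d) h1 h2 (t := h - 2 * d) (by linarith) (by linarith)]
  clear h1 h2
  rcases tri3 b h with ⟨k1, k2, k3, k4, k5⟩ | ⟨k1, k2, k3, k4, k5⟩ | ⟨k1, k2, k3, k4, k5⟩ <;>
    rcases tri3 (b + c) h with ⟨l1, l2, l3, l4, l5⟩ | ⟨l1, l2, l3, l4, l5⟩ | ⟨l1, l2, l3, l4, l5⟩ <;>
    simp only [k1, k2, k3, k4, k5, l1, l2, l3, l4, l5, and_self, and_true, true_and, and_false,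
      false_and, if_true, if_false] <;>
    first
    | linarith
    | exact absurd (by linarith [of_eq_true k5, of_eq_true l5]) hc
    | linarith [of_eq_true k5]
    | linarith [of_eq_true l5]

lemma exists_d (S : Finset ℝ) (h : ℝ) : ∃ d > 0, ∀ s ∈ S, s = h ∨ 2 * d < |s - h| := by
  induction S using Finset.induction_on with
  | empty => exact ⟨1, one_pos, by simp⟩
  | insert s S _ ih =>
    obtain ⟨d, hd, H⟩ := ih
    by_cases hs : s = h
    · refine ⟨d, hd, ?_⟩
      intro u hu
      rcases Finset.mem_insert.1 hu with rfl | hu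
      · exact Or.inl hs
      · exact H u hu
    · have hp : 0 < |s - h| := abs_pos.2 (sub_ne_zero.2 hs)
      refine ⟨min d (|s - h| / 3), lt_min hd (by positivity), ?_⟩
      intro u hu
      rcases Finset.mem_insert.1 hu with rfl | hu
      · right; linarith [min_le_right d (|u - h| / 3)]
      · rcases H u hu with e | e
        · exact Or.inl e
        · right; linarith [min_le_left d (|s - h| / 3)]

lemma local_ids (A B C : ℝ) (hC : 0 < C)
    (n : ℕ) (a b c : Fin n → ℝ) (hc : ∀ i, c i ≠ 0)
    (hdisj : ∀ i j, i ≠ j →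
      interior (Tri (a i) (b i) (c i)) ∩ interior (Tri (a j) (b j) (c j)) = ∅)
    (hunion : (⋃ i, Tri (a i) (b i) (c i)) = Tri A B C) (h : ℝ) :
    (∑ i, (if b i = h then c i else 0) = if B = h then C else 0) ∧
    (∑ i, ((if b i + c i = h then (1:ℝ) else 0) - (if b i = h then 1 else 0)) =
      (if B + C = h then 1 else 0) - (if B = h then 1 else 0)) := by
  obtain ⟨d, hd, H⟩ := exists_d (insert B (insert (B + C)
    (Finset.univ.image b ∪ Finset.univ.image (fun i => b i + c i)))) h
  have HB := H B (by simp)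
  have HC := H (B + C) (by simp)
  have Hb : ∀ i, b i = h ∨ 2 * d < |b i - h| := fun i => H (b i) (by simp)
  have Ha : ∀ i, b i + c i = h ∨ 2 * d < |b i + c i - h| := fun i => H (b i + c i) (by simp)
  have ne : ∀ s, (s = h ∨ 2 * d < |s - h|) → ∀ e, e ≠ 0 → |e| ≤ 2 * d → h + e ≠ s := by
    intro s hs e he hle heq
    rcases hs with hs | hs
    · apply he; linarith
    · rw [show s - h = e by linarith] at hs; linarith
  have key : ∀ e, e ≠ 0 → |e| ≤ 2 * d → ∑ i, FF (b i) (c i) (h + e) = FF B C (h + e) := by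
    intro e he hle
    exact slice_sum A B C hC n a b c hc hdisj hunion (h + e) (fun i => ne _ (Hb i) e he hle)
      (fun i => ne _ (Ha i) e he hle) (ne _ HB e he hle) (ne _ HC e he hle)
  have k1 := key d hd.ne' (by rw [abs_of_pos hd]; linarith)
  have k2 := key (2 * d) (by positivity) (by rw [abs_of_pos (by positivity)])
  have k3 := key (-d) (by simpa using hd.ne') (by rw [abs_neg, abs_of_pos hd]; linarith)
  have k4 := key (-(2 * d)) (by simpa using hd.ne') (by rw [abs_neg, abs_of_pos (by positivity)])
  rw [← sub_eq_add_neg] at k3 k4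
  constructor
  · rw [← FF_jump hC.ne' hd HB HC, ← k1, ← k2, ← k3, ← k4]
    rw [Finset.sum_congr rfl fun i _ => (FF_jump (hc i) hd (Hb i) (Ha i)).symm]
    simp only [Finset.sum_sub_distrib, Finset.mul_sum]
  · have e1 := FF_slope hC.ne' hd HB HC
    rw [← k1, ← k2, ← k3, ← k4] at e1
    have e2 := Finset.sum_congr (rfl : (Finset.univ : Finset (Fin n)) = _)
      fun i _ => (FF_slope (hc i) hd (Hb i) (Ha i))
    rw [← Finset.mul_sum] at e2
    simp only [Finset.sum_sub_distrib] at e2 e1 ⊢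
    rw [e2] at e1
    exact mul_left_cancel₀ hd.ne' e1

lemma det_le {V : Type*} [Fintype V] [DecidableEq V] (M : Matrix V V ℤ) :
    |M.det| ≤ ∏ v, ∑ w, |M v w| := by
  rw [← Matrix.det_transpose, Matrix.det_apply]
  refine (Finset.abs_sum_le_sum_abs _ _).trans ?_
  have h1 : ∀ σ : Equiv.Perm V, |Equiv.Perm.sign σ • ∏ i, M.transpose (σ i) i|
      = ∏ i, |M i (σ i)| := by
    intro σ
    rcases Int.units_eq_one_or (Equiv.Perm.sign σ) with h | h <;>
      simp [h, Finset.abs_prod, Matrix.transpose_apply]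
  rw [Finset.sum_congr rfl fun σ _ => h1 σ, Finset.prod_univ_sum, Fintype.piFinset_univ]
  rw [← Finset.sum_image (f := fun g : V → V => ∏ i, |M i (g i)|)
    (g := fun σ : Equiv.Perm V => (σ : V → V)) (s := Finset.univ)
    (fun x _ y _ h => DFunLike.coe_injective h)]
  exact Finset.sum_le_sum_of_subset_of_nonneg (Finset.subset_univ _)
    fun g _ _ => Finset.prod_nonneg fun i _ => abs_nonneg _

/-- extension by zero -/
noncomputable def extz (V : Finset ℝ) (x : V → ℤ) (r : ℝ) : ℤ :=
  if h : r ∈ V then x ⟨r, h⟩ else 0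

noncomputable def MM {n : ℕ} (b p : Fin n → ℝ) (V : Finset ℝ) : Matrix V V ℤ :=
  fun v w => ∑ i, if b i = v then
    ((if b i = w then 1 else 0) - (if p i = w then 1 else 0) : ℤ) else 0

lemma sum_ind {R : Type*} [CommRing R] (V : Finset ℝ) (f : ℝ → R) (r : ℝ) :
    ∑ w : V, (if r = (w : ℝ) then 1 else 0) * f w = if r ∈ V then f r else 0 := by
  rw [Finset.sum_coe_sort V (fun w => (if r = w then 1 else 0) * f w)]
  simp

lemma MM_mul {R : Type*} [CommRing R] {n : ℕ} (b p : Fin n → ℝ) (V : Finset ℝ)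
    (f : ℝ → R) (v : V) :
    ∑ w, (MM b p V v w : R) * f w = ∑ i, if b i = v then
      (f v - if p i ∈ V then f (p i) else 0) else 0 := by
  simp only [MM, Int.cast_sum, Finset.sum_mul]
  rw [Finset.sum_comm]
  apply Finset.sum_congr rfl
  intro i _
  by_cases h : b i = v
  · simp only [h, if_true, Int.cast_sub, Int.cast_ite, Int.cast_one, Int.cast_zero, sub_mul,
      Finset.sum_sub_distrib, sum_ind]
    simp
  · simp [h]

lemma MM_row {n : ℕ} (b p : Fin n → ℝ) (V : Finset ℝ) (v : V) :
    ∑ w, |MM b p V v w| ≤ 2 * ((Finset.univ.filter fun i => b i = v).card : ℤ) := by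
  have h1 : ∀ w, |MM b p V v w| ≤ ∑ i, if b i = v then
      ((if b i = (w : ℝ) then 1 else 0) * 1 + (if p i = (w : ℝ) then 1 else 0) * 1 : ℤ) else 0 := by
    intro w
    refine (Finset.abs_sum_le_sum_abs _ _).trans (Finset.sum_le_sum fun i _ => ?_)
    split_ifs <;> simp
  refine (Finset.sum_le_sum fun w _ => h1 w).trans ?_
  rw [Finset.sum_comm, Finset.card_filter]
  push_cast
  rw [Finset.mul_sum]
  apply Finset.sum_le_sum
  intro i _
  by_cases h : b i = v
  · simp only [h, if_true, Finset.sum_add_distrib]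
    rw [sum_ind V (fun _ => (1:ℤ)), sum_ind V (fun _ => (1:ℤ))]
    split_ifs <;> norm_num
  · simp [h]

lemma max_pr {n : ℕ} (b p : Fin n → ℝ) (V : Finset ℝ)
    (hup : ∀ v ∈ V, ∃ i, b i = v ∧ v < p i) (x : V → ℤ)
    (hx : ∀ v, (MM b p V).mulVec x v = 0) : ∀ v, x v ≤ 0 := by
  by_contra! hcon
  obtain ⟨v0, hv0⟩ := hcon
  have hne : V.attach.Nonempty := ⟨v0, by simp⟩
  obtain ⟨m, -, hm⟩ := V.attach.exists_max_image x hne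
  obtain ⟨v, hv, hvm⟩ := (V.attach.filter fun v => x v = x m).exists_max_image (fun v => (v : ℝ))
    ⟨m, by simp⟩
  simp only [Finset.mem_filter, Finset.mem_attach, true_and] at hv hvm hm
  have hmpos : 0 < x m := lt_of_lt_of_le hv0 (hm v0 trivial)
  have e := hx v
  have e' : ∑ w, (MM b p V v w : ℤ) * extz V x w = 0 := by
    rw [← e]; simp only [Matrix.mulVec, dotProduct]
    apply Finset.sum_congr rfl; intro w _; simp [extz]
  have e2 := MM_mul (R := ℤ) b p V (extz V x) v
  simp only [Int.cast_id] at e2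
  rw [e'] at e2
  have hle : ∀ r, (if r ∈ V then extz V x r else 0) ≤ x m := by
    intro r
    split_ifs with h
    · simp only [extz, h, dif_pos]; exact hm _ trivial
    · exact hmpos.le
  have hfv : extz V x v = x m := by simp [extz, hv]
  have e3 := (Finset.sum_eq_zero_iff_of_nonneg (s := Finset.univ) (f := fun i => if b i = v then
      (extz V x v - if p i ∈ V then extz V x (p i) else 0) else 0) (by
    intro i _
    show 0 ≤ ite _ _ _
    have := hle (p i)
    rw [hfv]
    split_ifs at this ⊢ <;> linarith)).1 e2.symm
  obtain ⟨i, hi, hlt⟩ := hup v v.2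
  have e4 := e3 i (Finset.mem_univ _)
  simp only [hi, if_true, hfv] at e4
  by_cases hp : p i ∈ V
  · simp only [hp, if_true] at e4
    have := hvm ⟨p i, hp⟩ (by simp only [extz, hp, dif_pos] at e4; linarith)
    simp only at this
    linarith
  · simp only [hp, if_false] at e4
    linarith

lemma MM_det {n : ℕ} (b p : Fin n → ℝ) (V : Finset ℝ)
    (hup : ∀ v ∈ V, ∃ i, b i = v ∧ v < p i) : (MM b p V).det ≠ 0 := by
  intro h
  obtain ⟨x, hx0, hx⟩ := Matrix.exists_mulVec_eq_zero_iff.2 h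
  apply hx0
  have h1 := max_pr b p V hup x (fun v => by rw [hx]; rfl)
  have h2 := max_pr b p V hup (-x) (fun v => by rw [Matrix.mulVec_neg, hx]; simp)
  ext v
  have := h1 v
  have := h2 v
  simp only [Pi.neg_apply] at this
  simp only [Pi.zero_apply]
  linarith

lemma two_mul_le_pow (d : ℕ) (hd : 1 ≤ d) : 2 * (d : ℤ) ≤ 2 ^ d := by
  induction d, hd using Nat.le_induction with
  | base => norm_num
  | succ k hk ih =>
    rw [pow_succ]; push_cast
    have : (1:ℤ) ≤ k := by exact_mod_cast hk
    linarith

/-- For any tiling of an equilateral triangle by n equilateral triangles, there is a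
positive scaling making all tile side lengths integers, with the side length of the
scaled triangle at most 4^((2n-2)/3). -/
theorem triangle_tiling_scaling_bound
    (A B C : ℝ) (hC : 0 < C)
    (n : ℕ) (a b c : Fin n → ℝ) (hc : ∀ i, c i ≠ 0)
    (hdisj : ∀ i j, i ≠ j →
      interior (Tri (a i) (b i) (c i)) ∩ interior (Tri (a j) (b j) (c j)) = ∅)
    (hunion : (⋃ i, Tri (a i) (b i) (c i)) = Tri A B C) :
    ∃ lam : ℝ, 0 < lam ∧ (∀ i, ∃ m : ℤ, lam * |c i| = m) ∧
      lam * C ≤ (4 : ℝ) ^ ((2 * (n : ℝ) - 2) / 3) := by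
  have ids := local_ids A B C hC n a b c hc hdisj hunion
  set p : Fin n → ℝ := fun i => b i + c i with hp
  set V : Finset ℝ := ((Finset.univ.image b).erase B).erase (B + C) with hV
  have memV : ∀ r, r ∈ V ↔ r ≠ B + C ∧ r ≠ B ∧ ∃ i, b i = r := by
    intro r; simp [hV]
  have hup : ∀ v ∈ V, ∃ i, b i = v ∧ v < p i := by
    intro v hv
    obtain ⟨h1, h2, j, hj⟩ := (memV v).1 hv
    by_contra! hcon
    have e := (ids v).1
    rw [if_neg (Ne.symm h2)] at e
    have hle : ∀ i, (if b i = v then c i else 0) ≤ 0 := by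
      intro i
      split_ifs with hi
      · have := hcon i hi
        simp only [hp] at this; linarith
      · exact le_rfl
    have := (Finset.sum_eq_zero_iff_of_nonpos (fun i _ => hle i)).1 e j (Finset.mem_univ _)
    rw [if_pos hj] at this
    exact hc j this
  have hapex : ∀ i, p i = B ∨ p i = B + C ∨ p i ∈ V := by
    intro i
    by_contra! hcon
    obtain ⟨h1, h2, h3⟩ := hcon
    have e := (ids (p i)).2
    rw [if_neg (Ne.symm h2), if_neg (Ne.symm h1)] at e
    have hb : ∀ j, b j ≠ p i := by
      intro j hj; exact h3 ((memV _).2 ⟨h2, h1, j, hj⟩)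
    simp only [hb, if_false, sub_zero] at e
    have := (Finset.sum_eq_zero_iff_of_nonneg (fun j _ => by split_ifs <;> norm_num)).1 e i
      (Finset.mem_univ _)
    simp [hp] at this
  have hbase : ∀ i, b i = B ∨ b i = B + C ∨ b i ∈ V := by
    intro i
    by_contra! hcon
    obtain ⟨h1, h2, h3⟩ := hcon
    exact h3 ((memV _).2 ⟨h2, h1, i, rfl⟩)
  have hdet := MM_det b p V hup
  set M := MM b p V with hM
  set D : ℤ := M.det with hD
  -- integrality
  have hint : ∀ v : V, ∃ m : ℤ, (D : ℝ) * ((v : ℝ) - B) = C * m := by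
    set k : V → ℤ := fun v => ∑ i, if b i = v then (if p i = B + C then 1 else 0) else 0 with hk
    have heq : ∀ v : V, ∑ w, (M v w : ℝ) * ((w : ℝ) - B) = C * k v := by
      intro v
      rw [hM, MM_mul b p V (fun r => r - B) v]
      have hvB : B ≠ v := fun h => ((memV v).1 v.2).2.1 h.symm
      have e := (ids v).1
      rw [if_neg hvB] at e
      rw [← sub_eq_zero, ← add_zero (_ - _), sub_add_eq_add_sub, sub_eq_zero]
      refine Eq.trans (congrArg _ e.symm) ?_
      rw [← Finset.sum_add_distrib]
      simp only [hk]
      push_cast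
      rw [Finset.mul_sum]
      apply Finset.sum_congr rfl
      intro i _
      by_cases hi : b i = v
      · simp only [hi, if_true]
        have hpi : p i = v + c i := by simp only [hp]; rw [hi]
        rcases hapex i with h | h | h
        · have h' : p i ∉ V := by rw [h]; intro hh; exact ((memV _).1 hh).2.1 rfl
          have h'' : p i ≠ B + C := by rw [h]; intro hh; linarith
          rw [if_neg h', if_neg h'']; linarith
        · have h' : p i ∉ V := by rw [h]; intro hh; exact ((memV _).1 hh).1 rfl
          rw [if_neg h', if_pos h]; linarith
        · rw [if_pos h, if_neg ((memV _).1 h).1]; linarith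
      · simp [hi]
    intro v
    refine ⟨(M.adjugate.mulVec k) v, ?_⟩
    have hmul : (M.map (Int.cast : ℤ → ℝ)).mulVec (fun w : V => (w : ℝ) - B)
        = C • (fun w => (k w : ℝ)) := by
      ext w
      simp only [Matrix.mulVec, dotProduct, Matrix.map_apply, Pi.smul_apply, smul_eq_mul]
      exact heq w
    have hadj : (M.adjugate.map (Int.cast : ℤ → ℝ)) * (M.map (Int.cast : ℤ → ℝ))
        = (D : ℝ) • (1 : Matrix V V ℝ) := by
      have := congrArg (fun N : Matrix V V ℤ => N.map (Int.castRingHom ℝ)) (Matrix.adjugate_mul M)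
      simp only [Matrix.map_mul] at this
      rw [show (Int.cast : ℤ → ℝ) = (Int.castRingHom ℝ) from rfl, this]
      ext i j
      show ((D * (1 : Matrix V V ℤ) i j : ℤ) : ℝ) = (D : ℝ) * (1 : Matrix V V ℝ) i j
      rw [Matrix.one_apply, Matrix.one_apply]
      split_ifs <;> simp
    have h2 := congrArg (fun x => (M.adjugate.map (Int.cast : ℤ → ℝ)).mulVec x) hmul
    simp only [Matrix.mulVec_mulVec, hadj, Matrix.smul_mulVec, Matrix.one_mulVec,
      Matrix.mulVec_smul] at h2
    have h3 := congrFun h2 v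
    simp only [Pi.smul_apply, smul_eq_mul] at h3
    rw [h3]
    simp [Matrix.mulVec, dotProduct]
  have hint2 : ∀ r : ℝ, (r = B ∨ r = B + C ∨ r ∈ V) → ∃ m : ℤ, (D : ℝ) * (r - B) = C * m := by
    rintro r (h | h | h)
    · exact ⟨0, by rw [h]; simp⟩
    · exact ⟨D, by rw [h]; ring⟩
    · exact hint ⟨r, h⟩
  have hDpos : (0 : ℝ) < |(D : ℝ)| := abs_pos.2 (by exact_mod_cast hdet)
  refine ⟨|(D : ℝ)| / C, by positivity, ?_, ?_⟩
  · intro i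
    obtain ⟨m1, hm1⟩ := hint2 _ (hapex i)
    obtain ⟨m2, hm2⟩ := hint2 _ (hbase i)
    refine ⟨|m1 - m2|, ?_⟩
    have : (D : ℝ) * c i = C * (m1 - m2) := by
      rw [mul_sub, ← hm1, ← hm2]; simp only [hp]; ring
    rw [div_mul_eq_mul_div, ← abs_mul, this, abs_mul, abs_of_pos hC]
    push_cast
    field_simp
  · rw [div_mul_cancel₀ _ hC.ne']
    -- a tile with base at height B
    have hB : ∃ i, b i = B := by
      by_contra! hcon
      have e := (ids B).1
      simp [hcon] at e
      exact hC.ne e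
    obtain ⟨i0, hi0⟩ := hB
    set dd : ℝ → ℕ := fun v => (Finset.univ.filter fun i => b i = v).card with hdd
    have hcard : ∑ v : V, dd v + 1 ≤ n := by
      rw [Finset.sum_coe_sort V dd]
      have h1 : ∑ v ∈ V, dd v = (Finset.univ.filter fun i => b i ∈ V).card := by
        rw [Finset.card_eq_sum_card_fiberwise (f := b) (t := V) (fun i hi => by simpa using hi)]
        apply Finset.sum_congr rfl
        intro v hv
        simp only [hdd]
        congr 1
        ext i
        simp only [Finset.mem_filter, Finset.mem_univ, true_and]
        constructor
        · intro h; exact ⟨h ▸ hv, h⟩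
        · exact fun h => h.2
      rw [h1]
      have : (Finset.univ.filter fun i => b i ∈ V).card < (Finset.univ : Finset (Fin n)).card := by
        apply Finset.card_lt_card
        rw [Finset.filter_ssubset]
        refine ⟨i0, Finset.mem_univ _, ?_⟩
        rw [hi0]; intro hh; exact ((memV _).1 hh).2.1 rfl
      simpa using this
    have hDle : |D| ≤ 2 ^ (∑ v : V, dd v) := by
      refine (det_le M).trans ?_
      rw [← Finset.prod_pow_eq_pow_sum]
      apply Finset.prod_le_prod
      · intro v _; exact Finset.sum_nonneg fun _ _ => abs_nonneg _
      · intro v _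
        refine (MM_row b p V v).trans (two_mul_le_pow _ ?_)
        obtain ⟨_, _, i, hi⟩ := (memV v).1 v.2
        exact Finset.card_pos.2 ⟨i, by simpa using hi⟩
    have h2 : |(D : ℝ)| ≤ 2 ^ (∑ v : V, dd v) := by exact_mod_cast hDle
    refine h2.trans ?_
    rw [show (4 : ℝ) = 2 ^ (2 : ℝ) by norm_num, ← Real.rpow_mul (by norm_num),
      ← Real.rpow_natCast]
    apply Real.rpow_le_rpow_of_exponent_le (by norm_num)
    have h3 : ((∑ v : V, dd v : ℕ) : ℝ) + 1 ≤ n := by exact_mod_cast hcard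
    have h4 : (0 : ℝ) ≤ ((∑ v : V, dd v : ℕ) : ℝ) := Nat.cast_nonneg _
    linarith
end
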